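/- arXiv:2010.00483 — 3 statements merged into one kernel-verified Lean document; each statement's English description precedes it below -/
import Mathlib

section
/- Concentration lemma under subgaussian concentration: Let Σ be a finite set with n elements, let w = (w_a)_{a∈Σ} be a random vector (not necessarily with independent components) satisfying subgaussian concentration with constants C, c for bounded Lipschitz functions, and let σ be a random subset of Σ of size m chosen independently of w. Then for any 0 < α ≤ ∞, any probability measure ν on ℝ, any t > 0, and any f : ℝ → ℝ with |f|_{BL} ≤ 1, P_w[ |∫ f dμ_w − ∫ f dν| > E + t ] ≤ C·exp(−c·m^{2/α}t²/L²). -/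
open MeasureTheory ProbabilityTheory Real Filter
open scoped ENNReal

/-- The bounded-Lipschitz distance: supremum of `|∫ f dμ - ∫ f dν|` over functions with
`|f|_{BL} ≤ 1`, i.e. `‖f‖_∞ ≤ 1` and `f` 1-Lipschitz. -/
noncomputable def blDist (μ ν : Measure ℝ) : ℝ :=
  ⨆ f : {f : ℝ → ℝ // (∀ x, |f x| ≤ 1) ∧ LipschitzWith 1 f},
    |(∫ x, f.1 x ∂μ) - ∫ x, f.1 x ∂ν|

/-- A function with values in `[-1, 1]` has integral in `[-1, 1]` for a probability measure. -/
theorem abs_integral_le_one {X : Type*} [MeasurableSpace X] (μ : Measure X)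
    [IsProbabilityMeasure μ] {f : X → ℝ} (hf : ∀ x, |f x| ≤ 1) : |∫ x, f x ∂μ| ≤ 1 := by
  simpa using norm_integral_le_of_norm_le_const (μ := μ) (f := f) (C := 1) (Eventually.of_forall hf)

theorem abs_integral_sub_le_blDist (μ ν : Measure ℝ) [IsProbabilityMeasure μ]
    [IsProbabilityMeasure ν] {f : ℝ → ℝ} (hfb : ∀ x, |f x| ≤ 1) (hfl : LipschitzWith 1 f) :
    |(∫ x, f x ∂μ) - ∫ x, f x ∂ν| ≤ blDist μ ν := by
  refine le_ciSup (f := fun f : {f : ℝ → ℝ // (∀ x, |f x| ≤ 1) ∧ LipschitzWith 1 f} =>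
    |(∫ x, f.1 x ∂μ) - ∫ x, f.1 x ∂ν|) ⟨2, ?_⟩ ⟨f, hfb, hfl⟩
  rintro _ ⟨g, rfl⟩
  have hμ := abs_integral_le_one μ g.2.1
  have hν := abs_integral_le_one ν g.2.1
  exact (abs_sub _ _).trans (by linarith)

/-- The quenched average of `f`, as a function of the weight vector. -/
noncomputable def quenchedAverage {ι : Type*} [Fintype ι] (q : Finset ι → ℝ)
    (s : ℝ) (f : ℝ → ℝ) (x : EuclideanSpace ℝ ι) : ℝ :=
  ∑ σ, q σ * f (s * ∑ a ∈ σ, x a)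

section quenchedAverage

variable {ι : Type*} [Fintype ι] {q : Finset ι → ℝ} {f : ℝ → ℝ} {s : ℝ}

theorem abs_quenchedAverage_le_one (hq0 : ∀ σ, 0 ≤ q σ) (hq1 : ∑ σ, q σ = 1)
    (hfb : ∀ x, |f x| ≤ 1) (x : EuclideanSpace ℝ ι) : |quenchedAverage q s f x| ≤ 1 := by
  refine (Finset.abs_sum_le_sum_abs _ _).trans ?_
  rw [← hq1]
  refine Finset.sum_le_sum fun σ _ => ?_
  rw [abs_mul, abs_of_nonneg (hq0 σ)]
  exact mul_le_of_le_one_right (hq0 σ) (hfb _)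

theorem abs_quenchedAverage_sub_le [DecidableEq ι] (hq0 : ∀ σ, 0 ≤ q σ) (hs : 0 ≤ s)
    (hfl : LipschitzWith 1 f) (x y : EuclideanSpace ℝ ι) :
    |quenchedAverage q s f x - quenchedAverage q s f y| ≤
      s * √(∑ a, (∑ σ ∈ Finset.univ.filter (fun σ => a ∈ σ), q σ) ^ 2) * ‖x - y‖ := by
  have hterm : ∀ σ : Finset ι, |q σ * f (s * ∑ a ∈ σ, x a) - q σ * f (s * ∑ a ∈ σ, y a)| ≤
      s * ∑ a ∈ σ, q σ * |x a - y a| := by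
    intro σ
    rw [← mul_sub, abs_mul, abs_of_nonneg (hq0 σ), ← Finset.mul_sum, mul_left_comm]
    refine mul_le_mul_of_nonneg_left ?_ (hq0 σ)
    have h := hfl.dist_le_mul (s * ∑ a ∈ σ, x a) (s * ∑ a ∈ σ, y a)
    rw [Real.dist_eq, Real.dist_eq, ← mul_sub, ← Finset.sum_sub_distrib, abs_mul,
      abs_of_nonneg hs, NNReal.coe_one, one_mul] at h
    exact h.trans (mul_le_mul_of_nonneg_left (Finset.abs_sum_le_sum_abs _ _) hs)
  have hswap : ∑ σ : Finset ι, ∑ a ∈ σ, q σ * |x a - y a| =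
      ∑ a, (∑ σ ∈ Finset.univ.filter (fun σ => a ∈ σ), q σ) * |x a - y a| := by
    simp_rw [Finset.sum_mul]
    exact Finset.sum_comm' (by simp)
  calc |quenchedAverage q s f x - quenchedAverage q s f y|
      ≤ ∑ σ, s * ∑ a ∈ σ, q σ * |x a - y a| := by
        rw [quenchedAverage, quenchedAverage, ← Finset.sum_sub_distrib]
        exact (Finset.abs_sum_le_sum_abs _ _).trans (Finset.sum_le_sum fun σ _ => hterm σ)
    _ = s * ∑ a, (∑ σ ∈ Finset.univ.filter (fun σ => a ∈ σ), q σ) * |x a - y a| := by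
        rw [← Finset.mul_sum, hswap]
    _ ≤ _ := by
        rw [mul_assoc]
        refine mul_le_mul_of_nonneg_left ?_ hs
        have h := Real.sum_mul_le_sqrt_mul_sqrt Finset.univ
          (fun a => ∑ σ ∈ Finset.univ.filter (fun σ => a ∈ σ), q σ) (fun a => |x a - y a|)
        simpa [EuclideanSpace.norm_eq] using h

end quenchedAverage

/-- The mean of the quenched average is within the largest annealed distance of `∫ f dν`. -/
theorem abs_integral_quenchedAverage_sub_le {ι : Type*} [Fintype ι] {Ω : Type*}
    [MeasurableSpace Ω] (P : Measure Ω) [IsProbabilityMeasure P]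
    {w : Ω → EuclideanSpace ℝ ι} (hw : Measurable w) {q : Finset ι → ℝ}
    (hq0 : ∀ σ, 0 ≤ q σ) (hq1 : ∑ σ, q σ = 1) (s : ℝ)
    (ν : Measure ℝ) [IsProbabilityMeasure ν] {f : ℝ → ℝ} (hfb : ∀ x, |f x| ≤ 1)
    (hfl : LipschitzWith 1 f) :
    |(∫ ω, quenchedAverage q s f (w ω) ∂P) - ∫ x, f x ∂ν| ≤
      ⨆ σ : {σ : Finset ι // q σ ≠ 0},
        blDist (Measure.map (fun ω => s * ∑ a ∈ σ.1, w ω a) P) ν := by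
  have hmeas : ∀ σ : Finset ι, Measurable fun ω => s * ∑ a ∈ σ, w ω a := by
    intro σ
    fun_prop
  have hint : ∀ σ : Finset ι, Integrable (fun ω => q σ * f (s * ∑ a ∈ σ, w ω a)) P := by
    intro σ
    refine Integrable.const_mul ?_ _
    exact Integrable.of_bound (hfl.continuous.measurable.comp (hmeas σ)).aestronglyMeasurable 1
      (Eventually.of_forall fun ω => hfb _)
  have hmean : (∫ ω, quenchedAverage q s f (w ω) ∂P) - ∫ x, f x ∂ν =
      ∑ σ, q σ * ((∫ x, f x ∂(Measure.map (fun ω => s * ∑ a ∈ σ, w ω a) P)) - ∫ x, f x ∂ν) := by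
    simp_rw [mul_sub, Finset.sum_sub_distrib, ← Finset.sum_mul, hq1, one_mul]
    unfold quenchedAverage
    rw [integral_finsetSum _ fun σ _ => hint σ]
    congr 1
    refine Finset.sum_congr rfl fun σ _ => ?_
    rw [integral_const_mul, integral_map (hmeas σ).aemeasurable
      hfl.continuous.aestronglyMeasurable]
  set E := ⨆ σ : {σ : Finset ι // q σ ≠ 0},
    blDist (Measure.map (fun ω => s * ∑ a ∈ σ.1, w ω a) P) ν with hE
  calc _ ≤ ∑ σ, q σ * E := by
        rw [hmean]
        refine (Finset.abs_sum_le_sum_abs _ _).trans (Finset.sum_le_sum fun σ _ => ?_)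
        rw [abs_mul, abs_of_nonneg (hq0 σ)]
        by_cases hσ : q σ = 0
        · simp [hσ]
        refine mul_le_mul_of_nonneg_left ?_ (hq0 σ)
        have := Measure.isProbabilityMeasure_map (μ := P) (hmeas σ).aemeasurable
        refine (abs_integral_sub_le_blDist _ ν hfb hfl).trans ?_
        exact le_ciSup (f := fun σ : {σ : Finset ι // q σ ≠ 0} =>
          blDist (Measure.map (fun ω => s * ∑ a ∈ σ.1, w ω a) P) ν)
          (Set.finite_range _).bddAbove ⟨σ, hσ⟩
    _ = E := by rw [← Finset.sum_mul, hq1, one_mul]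

/-- If the random subset is nonempty, its vector of inclusion probabilities is nonzero. -/
theorem sqrt_sum_inclusion_sq_pos {ι : Type*} [Fintype ι] [DecidableEq ι] {q : Finset ι → ℝ}
    (hq0 : ∀ σ, 0 ≤ q σ) (hq1 : ∑ σ, q σ = 1) (hne : ∀ σ, q σ ≠ 0 → σ.Nonempty) :
    0 < √(∑ a, (∑ σ ∈ Finset.univ.filter (fun σ => a ∈ σ), q σ) ^ 2) := by
  obtain ⟨σ, -, hσ⟩ := Finset.exists_ne_zero_of_sum_ne_zero (hq1.trans_ne one_ne_zero)
  obtain ⟨a, ha⟩ := hne σ hσ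
  refine Real.sqrt_pos.2 (Finset.sum_pos' (fun _ _ => sq_nonneg _) ⟨a, Finset.mem_univ a, ?_⟩)
  refine pow_pos (Finset.sum_pos' (fun τ _ => hq0 τ) ⟨σ, by simpa using ha, ?_⟩) 2
  exact (hq0 σ).lt_of_ne' hσ

/-- Concentration lemma under subgaussian concentration (SGC) for bounded Lipschitz functions. -/
theorem stmt2
    (ι : Type) [Fintype ι] [DecidableEq ι] (n : ℕ) (hn : Fintype.card ι = n)
    (Ω : Type) [MeasurableSpace Ω] (P : Measure Ω) [IsProbabilityMeasure P]
    (w : Ω → EuclideanSpace ℝ ι) (hw : Measurable w)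
    (C c : ℝ) (hC : 0 < C) (hc : 0 < c)
    -- subgaussian concentration for bounded 1-Lipschitz functions of the weight vector
    (hSGC : ∀ F : EuclideanSpace ℝ ι → ℝ, (∃ B, ∀ x, |F x| ≤ B) → LipschitzWith 1 F →
      ∀ u : ℝ, 0 < u →
        P {ω | u < |F (w ω) - ∫ ω', F (w ω') ∂P|} ≤ ENNReal.ofReal (C * Real.exp (-c * u ^ 2)))
    (m : ℕ) (hm : 0 < m)
    (q : Finset ι → ℝ) (hq0 : ∀ σ, 0 ≤ q σ) (hq1 : (∑ σ, q σ) = 1)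
    (hqcard : ∀ σ, q σ ≠ 0 → σ.card = m)
    (L : ℝ)
    (hL : L = Real.sqrt (∑ a, (∑ σ ∈ Finset.univ.filter (fun σ => a ∈ σ), q σ) ^ 2))
    (α : ℝ≥0∞) (hα : 0 < α)
    (ν : Measure ℝ) [IsProbabilityMeasure ν]
    (E : ℝ)
    (hE : E = ⨆ σ : {σ : Finset ι // q σ ≠ 0},
        blDist (Measure.map (fun ω => (m : ℝ) ^ (-α⁻¹.toReal) * ∑ a ∈ σ.1, w ω a) P) ν)
    (t : ℝ) (ht : 0 < t)
    (f : ℝ → ℝ) (hfb : ∀ x, |f x| ≤ 1) (hfl : LipschitzWith 1 f) :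
    P {ω | E + t <
          |(∑ σ, q σ * f ((m : ℝ) ^ (-α⁻¹.toReal) * ∑ a ∈ σ, w ω a)) - ∫ x, f x ∂ν|}
      ≤ ENNReal.ofReal
          (C * Real.exp (-c * (m : ℝ) ^ (2 * α⁻¹.toReal) * t ^ 2 / L ^ 2)) := by
  have hm' : (0 : ℝ) < m := Nat.cast_pos.2 hm
  set s : ℝ := (m : ℝ) ^ (-α⁻¹.toReal) with hs
  have hs0 : 0 < s := Real.rpow_pos_of_pos hm' _
  have hL0 : 0 < L := hL ▸ sqrt_sum_inclusion_sq_pos hq0 hq1 fun σ hσ =>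
    Finset.card_pos.1 (by rwa [hqcard σ hσ])
  have hK : 0 < s * L := mul_pos hs0 hL0
  have hlip : LipschitzWith 1 fun x => quenchedAverage q s f x / (s * L) := by
    refine LipschitzWith.of_dist_le_mul fun x y => ?_
    rw [NNReal.coe_one, one_mul, Real.dist_eq, ← sub_div, abs_div, abs_of_pos hK,
      div_le_iff₀ hK, dist_eq_norm, mul_comm, hL]
    exact abs_quenchedAverage_sub_le hq0 hs0.le hfl x y
  have hbdd : ∃ B, ∀ x, |quenchedAverage q s f x / (s * L)| ≤ B := by
    refine ⟨1 / (s * L), fun x => ?_⟩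
    rw [abs_div, abs_of_pos hK]
    exact div_le_div_of_nonneg_right (abs_quenchedAverage_le_one hq0 hq1 hfb x) hK.le
  have hmean : |(∫ ω, quenchedAverage q s f (w ω) ∂P) - ∫ x, f x ∂ν| ≤ E :=
    hE ▸ abs_integral_quenchedAverage_sub_le P hw hq0 hq1 s ν hfb hfl
  have hexp : -c * (m : ℝ) ^ (2 * α⁻¹.toReal) * t ^ 2 / L ^ 2 = -c * (t / (s * L)) ^ 2 := by
    have hpow : (m : ℝ) ^ (2 * α⁻¹.toReal) = (s ^ 2)⁻¹ := by
      rw [hs, Real.rpow_neg hm'.le, inv_pow, inv_inv, mul_comm, Real.rpow_mul hm'.le,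
        Real.rpow_two]
    rw [hpow]
    field_simp
  rw [hexp]
  refine (measure_mono fun ω hω => ?_).trans (hSGC _ hbdd hlip _ (div_pos ht hK))
  rw [Set.mem_ofPred_eq, integral_div, ← sub_div, abs_div, abs_of_pos hK,
    div_lt_div_iff_of_pos_right hK]
  have hω' : E + t < |quenchedAverage q s f (w ω) - ∫ x, f x ∂ν| := hω
  have htri := abs_sub_le (quenchedAverage q s f (w ω))
    (∫ ω, quenchedAverage q s f (w ω) ∂P) (∫ x, f x ∂ν)
  linarith
end

section
/- Convergence under subgaussian or subexponential concentration: Consider a family of finite sets Σ_N with n(N) elements carrying random weight vectors w_N satisfying SGC or SEC with fixed constants C, c for bounded Lipschitz functions, and random subsets σ of size m(N) chosen independently of the weights, where m(N) is of exact order N^μ and L(N) = O(N^λ). If μ/α > λ, then for every f : ℝ → ℝ with |f|_{BL} ≤ 1, every probability measure ν, and every ε > 0, both P_w[ |∫ f dμ_w − ∫ f dν| ≥ E_N + ε ] → 0 as N → ∞, and Σ_{N=1}^∞ P_w[ |∫ f dμ_w − ∫ f dν| > E_N + ε ] < ∞. -/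
open MeasureTheory ProbabilityTheory Real Filter
open scoped ENNReal

theorem summable_exp_neg_mul_nat_rpow {k δ : ℝ} (hk : 0 < k) (hδ : 0 < δ) :
    Summable fun N : ℕ => Real.exp (-k * (N : ℝ) ^ δ) := by
  have h := (isLittleO_exp_neg_mul_rpow_atTop hk (-2 / δ)).comp_tendsto
    ((tendsto_rpow_atTop hδ).comp tendsto_natCast_atTop_atTop)
  refine summable_of_isBigO_nat (Real.summable_nat_rpow.2 (by norm_num : (-2 : ℝ) < -1))
    (h.isBigO.congr_right fun N => ?_)
  simp only [Function.comp_apply]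
  rw [← Real.rpow_mul (Nat.cast_nonneg N), mul_div_cancel₀ _ hδ.ne']

theorem abs_sum_mul_le_of_sum_eq_one {S : Type*} [Fintype S] {q : S → ℝ}
    (hq0 : ∀ i, 0 ≤ q i) (hq1 : ∑ i, q i = 1) {g : S → ℝ} {b : ℝ} (hg : ∀ i, q i ≠ 0 → |g i| ≤ b) :
    |∑ i, q i * g i| ≤ b := by
  calc |∑ i, q i * g i| ≤ ∑ i, |q i * g i| := Finset.abs_sum_le_sum_abs _ _
    _ ≤ ∑ i, q i * b := by
      refine Finset.sum_le_sum fun i _ => ?_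
      rw [abs_mul, abs_of_nonneg (hq0 i)]
      by_cases h : q i = 0
      · simp [h]
      · exact mul_le_mul_of_nonneg_left (hg i h) (hq0 i)
    _ = b := by rw [← Finset.sum_mul, hq1, one_mul]

section RandomSubset

variable {κ : Type*} [Fintype κ]

/-- The average over a random subset `σ`, chosen with weights `q`, of `f (s * ∑ a ∈ σ, x a)`. -/
noncomputable def subsetAverage (q : Finset κ → ℝ) (s : ℝ) (f : ℝ → ℝ)
    (x : EuclideanSpace ℝ κ) : ℝ :=
  ∑ σ, q σ * f (s * ∑ a ∈ σ, x a)

theorem abs_subsetAverage_sub_le [DecidableEq κ] {q : Finset κ → ℝ} (hq0 : ∀ σ, 0 ≤ q σ)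
    {s : ℝ} (hs : 0 ≤ s) {f : ℝ → ℝ} (hf : LipschitzWith 1 f) (x y : EuclideanSpace ℝ κ) :
    |subsetAverage q s f x - subsetAverage q s f y| ≤
      s * Real.sqrt (∑ a, (∑ σ ∈ Finset.univ.filter (fun σ => a ∈ σ), q σ) ^ 2) * dist x y := by
  have hf' : ∀ u v, |f u - f v| ≤ |u - v| := fun u v => by
    simpa [Real.dist_eq] using hf.dist_le_mul u v
  calc |subsetAverage q s f x - subsetAverage q s f y|
      = |∑ σ, q σ * (f (s * ∑ a ∈ σ, x a) - f (s * ∑ a ∈ σ, y a))| := by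
        simp only [subsetAverage, mul_sub, Finset.sum_sub_distrib]
    _ ≤ ∑ σ, |q σ * (f (s * ∑ a ∈ σ, x a) - f (s * ∑ a ∈ σ, y a))| :=
        Finset.abs_sum_le_sum_abs _ _
    _ ≤ ∑ σ, q σ * (s * ∑ a ∈ σ, |x a - y a|) := by
        refine Finset.sum_le_sum fun σ _ => ?_
        rw [abs_mul, abs_of_nonneg (hq0 σ)]
        refine mul_le_mul_of_nonneg_left ((hf' _ _).trans ?_) (hq0 σ)
        rw [← mul_sub, abs_mul, abs_of_nonneg hs, ← Finset.sum_sub_distrib]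
        exact mul_le_mul_of_nonneg_left (Finset.abs_sum_le_sum_abs _ _) hs
    _ = s * ∑ a, (∑ σ ∈ Finset.univ.filter (fun σ => a ∈ σ), q σ) * |x a - y a| := by
        have h : ∀ σ : Finset κ, ∑ a ∈ σ, |x a - y a| =
            ∑ a, if a ∈ σ then |x a - y a| else 0 := fun σ => by simp
        simp only [h, Finset.mul_sum, Finset.sum_mul, Finset.sum_filter]
        rw [Finset.sum_comm]
        refine Finset.sum_congr rfl fun a _ => Finset.sum_congr rfl fun σ _ => ?_
        split_ifs <;> ring
    _ ≤ s * (Real.sqrt (∑ a, (∑ σ ∈ Finset.univ.filter (fun σ => a ∈ σ), q σ) ^ 2) *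
          dist x y) := by
        refine mul_le_mul_of_nonneg_left ?_ hs
        have h := Real.sum_mul_le_sqrt_mul_sqrt Finset.univ
          (fun a => ∑ σ ∈ Finset.univ.filter (fun σ => a ∈ σ), q σ) (fun a => |x a - y a|)
        simpa [EuclideanSpace.dist_eq, Real.dist_eq] using h
    _ = _ := by ring

variable {Ω : Type*} [MeasurableSpace Ω] {P : Measure Ω} [IsProbabilityMeasure P]
  {w : Ω → EuclideanSpace ℝ κ}

theorem abs_integral_subsetAverage_sub_le (hw : Measurable w) {q : Finset κ → ℝ}
    (hq0 : ∀ σ, 0 ≤ q σ) (hq1 : ∑ σ, q σ = 1) (s : ℝ) {f : ℝ → ℝ} (hfb : ∀ x, |f x| ≤ 1)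
    (hfl : LipschitzWith 1 f) (ν : Measure ℝ) [IsProbabilityMeasure ν] :
    |(∫ ω, subsetAverage q s f (w ω) ∂P) - ∫ x, f x ∂ν| ≤
      ⨆ σ : {σ : Finset κ // q σ ≠ 0},
        blDist (Measure.map (fun ω => s * ∑ a ∈ σ.1, w ω a) P) ν := by
  have hmeas : ∀ σ : Finset κ, Measurable fun ω => s * ∑ a ∈ σ, w ω a := fun σ => by
    fun_prop
  have hint : ∀ σ : Finset κ, Integrable (fun ω => f (s * ∑ a ∈ σ, w ω a)) P := fun σ =>
    Integrable.of_bound (hfl.continuous.measurable.comp (hmeas σ)).aestronglyMeasurable 1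
      (Eventually.of_forall fun ω => hfb _)
  have heq : (∫ ω, subsetAverage q s f (w ω) ∂P) - ∫ x, f x ∂ν =
      ∑ σ, q σ * ((∫ ω, f (s * ∑ a ∈ σ, w ω a) ∂P) - ∫ x, f x ∂ν) := by
    simp only [subsetAverage, mul_sub, Finset.sum_sub_distrib]
    rw [← Finset.sum_mul, hq1, one_mul, integral_finsetSum _ fun σ _ => (hint σ).const_mul _]
    simp only [integral_const_mul]
  rw [heq]
  refine abs_sum_mul_le_of_sum_eq_one hq0 hq1 fun σ hσ => ?_
  have := Measure.isProbabilityMeasure_map (μ := P) (hmeas σ).aemeasurable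
  have h := abs_integral_sub_le_blDist (Measure.map (fun ω => s * ∑ a ∈ σ, w ω a) P) ν hfb hfl
  rw [integral_map (hmeas σ).aemeasurable hfl.continuous.aestronglyMeasurable] at h
  exact h.trans (le_ciSup (f := fun σ : {σ : Finset κ // q σ ≠ 0} =>
    blDist (Measure.map (fun ω => s * ∑ a ∈ σ.1, w ω a) P) ν) (Set.finite_range _).bddAbove ⟨σ, hσ⟩)

/-- Any tail bound `φ` for bounded `1`-Lipschitz functions of `w` controls the deviation of the
quenched average from its limit, once rescaled by a bound `K` on the Lipschitz constant. -/
theorem measure_subsetAverage_deviation_le [DecidableEq κ] (hw : Measurable w)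
    {φ : ℝ → ℝ≥0∞}
    (hconc : ∀ F : EuclideanSpace ℝ κ → ℝ, (∃ B, ∀ x, |F x| ≤ B) → LipschitzWith 1 F →
      ∀ u : ℝ, 0 < u → P {ω | u < |F (w ω) - ∫ ω', F (w ω') ∂P|} ≤ φ u)
    {q : Finset κ → ℝ} (hq0 : ∀ σ, 0 ≤ q σ) (hq1 : ∑ σ, q σ = 1) {s : ℝ} (hs : 0 ≤ s)
    {f : ℝ → ℝ} (hfb : ∀ x, |f x| ≤ 1) (hfl : LipschitzWith 1 f)
    (ν : Measure ℝ) [IsProbabilityMeasure ν] {K : ℝ} (hK : 0 < K)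
    (hsK : s * Real.sqrt (∑ a, (∑ σ ∈ Finset.univ.filter (fun σ => a ∈ σ), q σ) ^ 2) ≤ K)
    {ε : ℝ} (hε : 0 < ε) :
    P {ω | (⨆ σ : {σ : Finset κ // q σ ≠ 0},
        blDist (Measure.map (fun ω => s * ∑ a ∈ σ.1, w ω a) P) ν) + ε ≤
          |subsetAverage q s f (w ω) - ∫ x, f x ∂ν|} ≤ φ (ε / 2 / K) := by
  have hlip : LipschitzWith 1 fun x => K⁻¹ * subsetAverage q s f x := by
    refine LipschitzWith.of_dist_le_mul fun x y => ?_
    rw [Real.dist_eq, ← mul_sub, abs_mul, abs_of_pos (inv_pos.2 hK), NNReal.coe_one, one_mul,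
      inv_mul_le_iff₀ hK]
    exact (abs_subsetAverage_sub_le hq0 hs hfl x y).trans
      (mul_le_mul_of_nonneg_right hsK dist_nonneg)
  have hbdd : ∃ B, ∀ x, |K⁻¹ * subsetAverage q s f x| ≤ B := by
    refine ⟨K⁻¹ * 1, fun x => ?_⟩
    rw [abs_mul, abs_of_pos (inv_pos.2 hK)]
    exact mul_le_mul_of_nonneg_left
      (abs_sum_mul_le_of_sum_eq_one hq0 hq1 fun σ _ => hfb _) (inv_pos.2 hK).le
  refine (measure_mono fun ω hω => ?_).trans (hconc _ hbdd hlip (ε / 2 / K) (by positivity))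
  have hmean := abs_integral_subsetAverage_sub_le (P := P) hw hq0 hq1 s hfb hfl ν
  have htri := abs_sub_le (subsetAverage q s f (w ω)) (∫ ω, subsetAverage q s f (w ω) ∂P)
    (∫ x, f x ∂ν)
  simp only [Set.mem_ofPred_eq] at hω ⊢
  rw [integral_const_mul, ← mul_sub, abs_mul, abs_of_pos (inv_pos.2 hK), div_eq_inv_mul]
  exact mul_lt_mul_of_pos_left (by linarith) (inv_pos.2 hK)

end RandomSubset

/-- Convergence under subgaussian or subexponential concentration. -/
theorem stmt6
    (ι : ℕ → Type) [∀ N, Fintype (ι N)] [∀ N, DecidableEq (ι N)]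
    (m : ℕ → ℕ) (hm : ∀ N, 0 < m N)
    (Ω : ℕ → Type) [∀ N, MeasurableSpace (Ω N)]
    (P : ∀ N, Measure (Ω N)) [∀ N, IsProbabilityMeasure (P N)]
    (w : ∀ N, Ω N → EuclideanSpace ℝ (ι N))
    (hwmeas : ∀ N, Measurable (w N))
    (C c : ℝ) (hC : 0 < C) (hc : 0 < c)
    -- the weight vectors satisfy SGC or SEC, with constants C, c, for bounded
    -- 1-Lipschitz functions
    (hconc :
      (∀ N, ∀ F : EuclideanSpace ℝ (ι N) → ℝ, (∃ B, ∀ x, |F x| ≤ B) → LipschitzWith 1 F →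
        ∀ u : ℝ, 0 < u →
          P N {ω | u < |F (w N ω) - ∫ ω', F (w N ω') ∂(P N)|}
            ≤ ENNReal.ofReal (C * Real.exp (-c * u ^ 2))) ∨
      (∀ N, ∀ F : EuclideanSpace ℝ (ι N) → ℝ, (∃ B, ∀ x, |F x| ≤ B) → LipschitzWith 1 F →
        ∀ u : ℝ, 0 < u →
          P N {ω | u < |F (w N ω) - ∫ ω', F (w N ω') ∂(P N)|}
            ≤ ENNReal.ofReal (C * Real.exp (-c * u))))
    (q : ∀ N, Finset (ι N) → ℝ)
    (hq0 : ∀ N σ, 0 ≤ q N σ) (hq1 : ∀ N, (∑ σ, q N σ) = 1)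
    (hqcard : ∀ N σ, q N σ ≠ 0 → σ.card = m N)
    (L : ℕ → ℝ)
    (hL : ∀ N, L N =
      Real.sqrt (∑ a, (∑ σ ∈ Finset.univ.filter (fun σ => a ∈ σ), q N σ) ^ 2))
    -- asymptotics: m(N) of exact order N^μ, L(N) = O(N^λ)
    (μ' lam : ℝ)
    (hmexact : ∃ c₁ c₂ : ℝ, 0 < c₁ ∧ 0 < c₂ ∧ ∀ N : ℕ, 1 ≤ N →
      c₁ * (N : ℝ) ^ μ' ≤ (m N : ℝ) ∧ (m N : ℝ) ≤ c₂ * (N : ℝ) ^ μ')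
    (hLO : ∃ Cl : ℝ, ∀ N : ℕ, 1 ≤ N → L N ≤ Cl * (N : ℝ) ^ lam)
    (α : ℝ≥0∞) (hα : 0 < α)
    -- the exponent condition μ/α > λ (read as 0 > λ when α = ∞)
    (hcond : lam < μ' * α⁻¹.toReal)
    (ν : Measure ℝ) [IsProbabilityMeasure ν]
    (E : ℕ → ℝ)
    (hE : ∀ N, E N = ⨆ σ : {σ : Finset (ι N) // q N σ ≠ 0},
        blDist
          (Measure.map (fun ω => (m N : ℝ) ^ (-α⁻¹.toReal) * ∑ a ∈ σ.1, w N ω a) (P N)) ν)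
    (f : ℝ → ℝ) (hfb : ∀ x, |f x| ≤ 1) (hfl : LipschitzWith 1 f)
    (ε : ℝ) (hε : 0 < ε) :
    Tendsto
      (fun N => P N
        {ω | E N + ε ≤
            |(∑ σ, q N σ * f ((m N : ℝ) ^ (-α⁻¹.toReal) * ∑ a ∈ σ, w N ω a)) -
              ∫ x, f x ∂ν|})
      atTop (nhds 0) ∧
    (∑' N : ℕ, P N
        {ω | E N + ε <
            |(∑ σ, q N σ * f ((m N : ℝ) ^ (-α⁻¹.toReal) * ∑ a ∈ σ, w N ω a)) -
              ∫ x, f x ∂ν|}) < ⊤ := by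
  obtain ⟨c₁, c₂, hc₁, -, hm'⟩ := hmexact
  obtain ⟨Cl, hCl⟩ := hLO
  set t := α⁻¹.toReal with ht
  have ht0 : 0 ≤ t := ENNReal.toReal_nonneg
  set δ := μ' * t - lam with hδ
  have hδ0 : 0 < δ := sub_pos.2 hcond
  set A := c₁ ^ (-t) * (|Cl| + 1) with hA
  have hA0 : 0 < A := by positivity
  have hsK : ∀ N : ℕ, 1 ≤ N → (m N : ℝ) ^ (-t) * L N ≤ A * (N : ℝ) ^ (-δ) := by
    intro N hN
    have hN0 : (0 : ℝ) < N := by exact_mod_cast hN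
    have h₁ : (m N : ℝ) ^ (-t) ≤ c₁ ^ (-t) * (N : ℝ) ^ (-(μ' * t)) := by
      calc (m N : ℝ) ^ (-t) ≤ (c₁ * (N : ℝ) ^ μ') ^ (-t) :=
            Real.rpow_le_rpow_of_nonpos (by positivity) (hm' N hN).1 (by linarith)
        _ = c₁ ^ (-t) * (N : ℝ) ^ (-(μ' * t)) := by
            rw [Real.mul_rpow hc₁.le (by positivity), ← Real.rpow_mul hN0.le, mul_neg]
    have h₂ : L N ≤ (|Cl| + 1) * (N : ℝ) ^ lam :=
      (hCl N hN).trans (mul_le_mul_of_nonneg_right (by linarith [le_abs_self Cl]) (by positivity))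
    have hL0 : 0 ≤ L N := by rw [hL]; positivity
    calc (m N : ℝ) ^ (-t) * L N
        ≤ c₁ ^ (-t) * (N : ℝ) ^ (-(μ' * t)) * ((|Cl| + 1) * (N : ℝ) ^ lam) :=
          mul_le_mul h₁ h₂ hL0 (by positivity)
      _ = A * ((N : ℝ) ^ (-(μ' * t)) * (N : ℝ) ^ lam) := by rw [hA]; ring
      _ = A * (N : ℝ) ^ (-δ) := by
          rw [← Real.rpow_add hN0]; congr 2; rw [hδ]; ring
  have hu : ∀ N : ℕ, ε / 2 / (A * (N : ℝ) ^ (-δ)) = ε / 2 / A * (N : ℝ) ^ δ := fun N => by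
    rw [Real.rpow_neg (Nat.cast_nonneg N), ← div_div, div_inv_eq_mul]
  have hdev : ∀ φ : ℝ → ℝ≥0∞, (∀ N, ∀ F : EuclideanSpace ℝ (ι N) → ℝ, (∃ B, ∀ x, |F x| ≤ B) →
      LipschitzWith 1 F → ∀ u : ℝ, 0 < u →
        P N {ω | u < |F (w N ω) - ∫ ω', F (w N ω') ∂(P N)|} ≤ φ u) → ∀ N : ℕ, 1 ≤ N →
      P N {ω | E N + ε ≤
        |(∑ σ, q N σ * f ((m N : ℝ) ^ (-t) * ∑ a ∈ σ, w N ω a)) - ∫ x, f x ∂ν|} ≤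
          φ (ε / 2 / A * (N : ℝ) ^ δ) := by
    intro φ hφ N hN
    have hN0 : (0 : ℝ) < N := by exact_mod_cast hN
    rw [← hu, hE N]
    exact measure_subsetAverage_deviation_le (hwmeas N) (hφ N) (hq0 N) (hq1 N) (by positivity)
      hfb hfl ν (by positivity) (by simpa only [hL N] using hsK N hN) hε
  obtain ⟨g, hg, hPg⟩ : ∃ g : ℕ → ℝ, Summable g ∧ ∀ N : ℕ, 1 ≤ N → P N {ω | E N + ε ≤
      |(∑ σ, q N σ * f ((m N : ℝ) ^ (-t) * ∑ a ∈ σ, w N ω a)) - ∫ x, f x ∂ν|} ≤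
        ENNReal.ofReal (g N) := by
    rcases hconc with h | h
    · refine ⟨fun N => C * Real.exp (-(c * (ε / 2 / A) ^ 2) * (N : ℝ) ^ (δ * 2)),
        (summable_exp_neg_mul_nat_rpow (by positivity) (by positivity)).mul_left C, fun N hN =>
          (hdev (fun u => ENNReal.ofReal (C * Real.exp (-c * u ^ 2))) h N hN).trans_eq ?_⟩
      simp only
      rw [Real.rpow_mul (Nat.cast_nonneg N), Real.rpow_two]
      congr 3
      ring
    · refine ⟨fun N => C * Real.exp (-(c * (ε / 2 / A)) * (N : ℝ) ^ δ),
        (summable_exp_neg_mul_nat_rpow (by positivity) hδ0).mul_left C, fun N hN =>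
          (hdev (fun u => ENNReal.ofReal (C * Real.exp (-c * u))) h N hN).trans_eq ?_⟩
      simp only
      congr 3
      ring
  constructor
  · refine tendsto_of_tendsto_of_tendsto_of_le_of_le' tendsto_const_nhds
      (by simpa using ENNReal.tendsto_ofReal hg.tendsto_atTop_zero)
      (Eventually.of_forall fun N => zero_le)
      ((eventually_ge_atTop 1).mono hPg)
  · rw [tsum_eq_zero_add' ENNReal.summable]
    refine ENNReal.add_lt_top.2 ⟨measure_lt_top _ _, lt_of_le_of_lt
      (ENNReal.tsum_le_tsum fun N => (measure_mono fun ω hω => ?_).trans (hPg (N + 1) (by omega)))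
      ((summable_nat_add_iff 1).2 hg).tsum_ofReal_lt_top⟩
    simp only [Set.mem_ofPred_eq] at hω ⊢
    exact hω.le
end

section
/- Quenched CLT along up-right paths with spherical weights: Let M = ⌊ξN⌋ with ξ > 0 fixed, and let the weight vector w = (w_{i,j})_{(i,j)∈□_{N,M}} be uniformly distributed on the sphere √(NM)·S^{NM−1} of radius √(NM) in ℝ^{NM}. Let σ be chosen uniformly at random from all up-right paths from (1,1) to (N,M), independently of w. Then P_w-almost surely, the quenched law of (M+N−1)^{−1/2} Σ_{(i,j)∈σ} (w_{i,j} − E w_{i,j}) converges weakly to the standard Gaussian distribution N(0,1) as N → ∞. -/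
open MeasureTheory ProbabilityTheory Real Filter

/-- The grid `□_{N,M} = {(i,j) : 1 ≤ i ≤ N, 1 ≤ j ≤ M}`. -/
def box (N M : ℕ) : Finset (ℕ × ℕ) := Finset.Icc 1 N ×ˢ Finset.Icc 1 M

/-- `s` is the set of sites of an up-right path from `(1,1)` to `(N,M)`. -/
def IsUpRightPath (N M : ℕ) (s : Finset (ℕ × ℕ)) : Prop :=
  ∃ c : ℕ → ℕ × ℕ, c 0 = (1, 1) ∧ c (N + M - 2) = (N, M) ∧
    (∀ k, k < N + M - 2 →
      c (k + 1) = ((c k).1 + 1, (c k).2) ∨ c (k + 1) = ((c k).1, (c k).2 + 1)) ∧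
    s = (Finset.range (N + M - 1)).image c

open scoped Classical in
/-- All up-right paths from `(1,1)` to `(N,M)`, as sets of sites. -/
noncomputable def upRightPaths (N M : ℕ) : Finset (Finset (ℕ × ℕ)) :=
  (box N M).powerset.filter (fun s => IsUpRightPath N M s)

/-- The quenched average `E_σ f((M+N-1)^{-1/2} Σ_{(i,j)∈σ} (W_{i,j} - E W_{i,j}))` over a
uniformly random up-right path `σ`, with `Wbar` the array of means. -/
noncomputable def pathAvgCentered (N M : ℕ) (W Wbar : ↥(box N M) → ℝ) (f : ℝ → ℝ) : ℝ :=
  ((upRightPaths N M).card : ℝ)⁻¹ *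
    ∑ s ∈ upRightPaths N M,
      f ((Real.sqrt ((M + N - 1 : ℕ) : ℝ))⁻¹ *
        ∑ a : ↥(box N M), if (a : ℕ × ℕ) ∈ s then W a - Wbar a else 0)

/-- The uniform (normalized Hausdorff) probability measure on the sphere of radius `r`
centered at the origin of the Euclidean space `ℝ^ι`. -/
noncomputable def sphereUniform (ι : Type) [Fintype ι] (r : ℝ) :
    Measure (EuclideanSpace ℝ ι) :=
  (μH[((Fintype.card ι - 1 : ℕ) : ℝ)] (Metric.sphere (0 : EuclideanSpace ℝ ι) r))⁻¹ •
    (μH[((Fintype.card ι - 1 : ℕ) : ℝ)]).restrict (Metric.sphere (0 : EuclideanSpace ℝ ι) r)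


/-- A bounded `c`-Lipschitz function of a standard Gaussian variable is sub-Gaussian around its
mean. -/
lemma integral_exp_sub_integral_gaussianReal_le {f : ℝ → ℝ} {c B : ℝ}
    (hfm : Measurable f) (hB : ∀ x, |f x| ≤ B) (hf : ∀ x y, |f x - f y| ≤ c * |x - y|) :
    ∫ x, exp (f x - ∫ y, f y ∂(gaussianReal 0 1)) ∂(gaussianReal 0 1) ≤ exp (c ^ 2) := by
  set γ := gaussianReal 0 1 with hγ
  have hc : 0 ≤ c := by simpa using (abs_nonneg _).trans (hf 1 0)
  have hbdd : ∀ {g : ℝ → ℝ}, Measurable g → (∀ x, |g x| ≤ B) →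
      Integrable g γ ∧ Integrable (fun x => exp (g x)) γ := by
    intro g hg hgB
    refine ⟨Integrable.of_bound hg.aestronglyMeasurable B (ae_of_all _ hgB),
      Integrable.of_bound (by fun_prop) (exp B) (ae_of_all _ fun x => ?_)⟩
    rw [norm_eq_abs, abs_of_pos (exp_pos _)]
    exact exp_le_exp.2 ((le_abs_self _).trans (hgB x))
  obtain ⟨hfi, hfe⟩ := hbdd hfm hB
  obtain ⟨hfi', hfe'⟩ := hbdd (g := fun x => -f x) hfm.neg (by simpa using hB)
  have hexp : ∀ t : ℝ, Integrable (fun x => exp (t * x)) γ ∧ ∫ x, exp (t * x) ∂γ = exp (t ^ 2 / 2) := by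
    intro t
    refine ⟨by simpa using integrable_exp_mul_gaussianReal (μ := 0) (v := 1) t, ?_⟩
    have := congrFun (mgf_id_gaussianReal (μ := 0) (v := 1)) t
    simpa [mgf] using this
  have hjensen : exp (-∫ y, f y ∂γ) ≤ ∫ y, exp (-f y) ∂γ := by
    rw [← integral_neg]
    exact convexOn_exp.map_integral_le continuousOn_exp isClosed_univ (by simp) hfi' hfe'
  have hsub : ∫ x, exp (f x - ∫ y, f y ∂γ) ∂γ ≤ ∫ p : ℝ × ℝ, exp (f p.1 - f p.2) ∂(γ.prod γ) := by
    calc ∫ x, exp (f x - ∫ y, f y ∂γ) ∂γ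
        = (∫ x, exp (f x) ∂γ) * exp (-∫ y, f y ∂γ) := by
          rw [← integral_mul_const]; simp_rw [sub_eq_add_neg, exp_add]
      _ ≤ (∫ x, exp (f x) ∂γ) * ∫ y, exp (-f y) ∂γ := by
          gcongr
      _ = _ := by
          rw [← integral_prod_mul]; simp_rw [sub_eq_add_neg, exp_add]
  have hint : ∀ {g h : ℝ → ℝ}, Integrable (fun x => exp (g x)) γ →
      Integrable (fun x => exp (h x)) γ → Integrable (fun p : ℝ × ℝ => exp (g p.1 + h p.2)) (γ.prod γ) := by
    intro g h hg hh
    simpa only [exp_add] using hg.mul_prod hh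
  have hI := hint hfe hfe'
  have hI' := hint hfe' hfe
  have hG := hint (hexp c).1 (hexp (-c)).1
  have hG' := hint (hexp (-c)).1 (hexp c).1
  have hval : ∀ t : ℝ, ∫ p : ℝ × ℝ, exp (t * p.1 + -t * p.2) ∂(γ.prod γ) = exp (t ^ 2) := by
    intro t
    simp_rw [exp_add]
    rw [integral_prod_mul (fun x => exp (t * x)) (fun x => exp (-t * x)), (hexp t).2, (hexp (-t)).2,
      ← exp_add]
    ring_nf
  have hswap : ∫ p : ℝ × ℝ, exp (-f p.1 + f p.2) ∂(γ.prod γ)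
      = ∫ p : ℝ × ℝ, exp (f p.1 + -f p.2) ∂(γ.prod γ) := by
    rw [← integral_prod_swap]
    simp [add_comm]
  refine hsub.trans ?_
  have hcosh : ∫ p : ℝ × ℝ, (exp (f p.1 + -f p.2) + exp (-f p.1 + f p.2)) ∂(γ.prod γ)
      ≤ ∫ p : ℝ × ℝ, (exp (c * p.1 + -c * p.2) + exp (-c * p.1 + c * p.2)) ∂(γ.prod γ) := by
    refine integral_mono (hI.add hI') (hG.add hG') fun p => ?_
    have h1 : cosh (f p.1 - f p.2) ≤ cosh (c * (p.1 - p.2)) := by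
      rw [cosh_le_cosh, abs_mul, abs_of_nonneg hc]
      exact hf _ _
    rw [cosh_eq, cosh_eq] at h1
    have e1 : f p.1 - f p.2 = f p.1 + -f p.2 := by ring
    have e2 : -(f p.1 - f p.2) = -f p.1 + f p.2 := by ring
    have e3 : c * (p.1 - p.2) = c * p.1 + -c * p.2 := by ring
    have e4 : -(c * (p.1 - p.2)) = -c * p.1 + c * p.2 := by ring
    rw [e2, e4, e1, e3] at h1
    simp only
    linarith
  rw [integral_add hI hI', integral_add hG hG', hswap, hval c] at hcosh
  have := hval (-c)
  rw [neg_neg, neg_sq] at this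
  rw [this] at hcosh
  simp_rw [sub_eq_add_neg]
  linarith

/-- Sub-Gaussian concentration for bounded functions of independent standard Gaussian variables
which are Lipschitz in every coordinate. -/
lemma integral_exp_sub_integral_pi_fin_le {B : ℝ} : ∀ (n : ℕ) {F : (Fin n → ℝ) → ℝ} {c : Fin n → ℝ},
    Measurable F → (∀ x, |F x| ≤ B) →
    (∀ x i s t, |F (Function.update x i s) - F (Function.update x i t)| ≤ c i * |s - t|) →
    ∫ x, exp (F x - ∫ y, F y ∂(Measure.pi fun _ => gaussianReal 0 1))
      ∂(Measure.pi fun _ => gaussianReal 0 1) ≤ exp (∑ i, c i ^ 2)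
  | 0, F, c, _, _, _ => by
    have h : ∀ x, F x = F default := fun x => by rw [Subsingleton.elim x default]
    simp [h]
  | n + 1, F, c, hFm, hB, hF => by
    set γ := gaussianReal 0 1 with hγ
    have hmp := (measurePreserving_piFinSuccAbove (fun _ : Fin (n + 1) => γ) 0).symm
    have htr : ∀ G : (Fin (n + 1) → ℝ) → ℝ, ∫ x, G x ∂(Measure.pi fun _ => γ)
        = ∫ p : ℝ × (Fin n → ℝ), G (Fin.cons p.1 p.2) ∂(γ.prod (Measure.pi fun _ => γ)) := by
      intro G
      rw [← hmp.integral_comp']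
      simp [MeasurableEquiv.piFinSuccAbove, Fin.insertNthEquiv]
    set ρ := Measure.pi fun _ : Fin n => γ with hρ
    have hcons : Measurable fun p : ℝ × (Fin n → ℝ) => F (Fin.cons p.1 p.2) := by
      refine hFm.comp (measurable_pi_iff.2 fun i => ?_)
      refine Fin.cases ?_ (fun j => ?_) i <;> simp <;> fun_prop
    set Fb : (Fin n → ℝ) → ℝ := fun y => ∫ x, F (Fin.cons x y) ∂γ with hFb
    have hFi : Integrable (fun p : ℝ × (Fin n → ℝ) => F (Fin.cons p.1 p.2)) (γ.prod ρ) :=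
      Integrable.of_bound hcons.aestronglyMeasurable B (ae_of_all _ fun p => hB _)
    have hFi1 : ∀ y, Integrable (fun x => F (Fin.cons x y)) γ := fun y =>
      Integrable.of_bound (hcons.comp (measurable_id.prodMk measurable_const)).aestronglyMeasurable B
        (ae_of_all _ fun p => hB _)
    have hFbm : Measurable Fb :=
      (hcons.stronglyMeasurable.integral_prod_left (μ := γ)).measurable
    have hFbB : ∀ y, |Fb y| ≤ B := by
      intro y
      have := norm_integral_le_of_norm_le_const (μ := γ) (f := fun x => F (Fin.cons x y)) (C := B)
        (ae_of_all _ fun x => hB _)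
      simpa using this
    have hmean : ∫ x, F x ∂(Measure.pi fun _ => γ) = ∫ y, Fb y ∂ρ := by
      rw [htr, integral_prod_symm _ hFi]
    rw [hmean, htr]
    set m := ∫ y, Fb y ∂ρ with hm
    have hEi : Integrable (fun p : ℝ × (Fin n → ℝ) => exp (F (Fin.cons p.1 p.2) - m)) (γ.prod ρ) := by
      refine Integrable.of_bound (hcons.sub_const m).exp.aestronglyMeasurable (exp (B - m)) (ae_of_all _ fun x => ?_)
      rw [norm_eq_abs, abs_of_pos (exp_pos _)]
      exact exp_le_exp.2 (sub_le_sub_right ((le_abs_self _).trans (hB _)) _)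
    have hFe : Integrable (fun y => exp (Fb y - m)) ρ := by
      refine Integrable.of_bound (by fun_prop) (exp (B - m)) (ae_of_all _ fun x => ?_)
      rw [norm_eq_abs, abs_of_pos (exp_pos _)]
      exact exp_le_exp.2 (sub_le_sub_right ((le_abs_self _).trans (hFbB _)) _)
    rw [integral_prod_symm _ hEi]
    have hstep : ∀ y, ∫ x, exp (F (Fin.cons x y) - m) ∂γ ≤ exp (c 0 ^ 2) * exp (Fb y - m) := by
      intro y
      have h1 := integral_exp_sub_integral_gaussianReal_le (f := fun x => F (Fin.cons x y))
        (c := c 0) (B := B) (hcons.comp (measurable_id.prodMk measurable_const))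
        (fun x => hB _) (fun s t => by
          have := hF (Fin.cons 0 y) 0 s t
          simpa using this)
      calc ∫ x, exp (F (Fin.cons x y) - m) ∂γ
          = (∫ x, exp (F (Fin.cons x y) - Fb y) ∂γ) * exp (Fb y - m) := by
            rw [← integral_mul_const]; simp_rw [← exp_add]; simp
        _ ≤ _ := by gcongr
    calc ∫ y, ∫ x, exp (F (Fin.cons x y) - m) ∂γ ∂ρ
        ≤ ∫ y, exp (c 0 ^ 2) * exp (Fb y - m) ∂ρ :=
          integral_mono hEi.integral_prod_right (hFe.const_mul _) hstep
      _ = exp (c 0 ^ 2) * ∫ y, exp (Fb y - m) ∂ρ := integral_const_mul _ _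
      _ ≤ exp (c 0 ^ 2) * exp (∑ i, c (Fin.succ i) ^ 2) := by
          gcongr
          refine integral_exp_sub_integral_pi_fin_le n hFbm hFbB fun x i s t => ?_
          simp only [hFb]
          rw [← integral_sub (hFi1 _) (hFi1 _)]
          have := norm_integral_le_of_norm_le_const (μ := γ)
            (f := fun u => F (Fin.cons u (Function.update x i s)) -
              F (Fin.cons u (Function.update x i t))) (C := c i.succ * |s - t|)
            (ae_of_all _ fun u => by
              have := hF (Fin.cons u x) i.succ s t
              simpa [Fin.cons_update] using this)
          simpa using this
      _ = _ := by rw [← exp_add, Fin.sum_univ_succ]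

/-- Sub-Gaussian concentration for bounded functions of independent standard Gaussian variables
which are Lipschitz in every coordinate. -/
lemma integral_exp_sub_integral_pi_le {ι : Type*} [Fintype ι] [DecidableEq ι] {B : ℝ}
    {F : (ι → ℝ) → ℝ} {c : ι → ℝ} (hFm : Measurable F) (hB : ∀ x, |F x| ≤ B)
    (hF : ∀ x i s t, |F (Function.update x i s) - F (Function.update x i t)| ≤ c i * |s - t|) :
    ∫ x, exp (F x - ∫ y, F y ∂(Measure.pi fun _ => gaussianReal 0 1))
      ∂(Measure.pi fun _ => gaussianReal 0 1) ≤ exp (∑ i, c i ^ 2) := by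
  let e := (Fintype.equivFin ι).symm
  have hmp := measurePreserving_piCongrLeft (fun _ : ι => gaussianReal 0 1) e
  have happ : ∀ x, MeasurableEquiv.piCongrLeft (fun _ : ι => ℝ) e x = x ∘ e.symm := by
    intro x; ext i
    obtain ⟨j, rfl⟩ := e.surjective i
    simp [MeasurableEquiv.coe_piCongrLeft]
  have htr : ∀ G : (ι → ℝ) → ℝ, ∫ x, G x ∂(Measure.pi fun _ => gaussianReal 0 1)
      = ∫ x, G (x ∘ e.symm) ∂(Measure.pi fun _ => gaussianReal 0 1) := by
    intro G
    rw [← hmp.integral_comp']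
    simp_rw [happ]
  rw [htr, htr, ← e.sum_comp]
  refine integral_exp_sub_integral_pi_fin_le _ (hFm.comp (by fun_prop)) (fun x => hB _)
    fun x i s t => ?_
  have := hF (x ∘ e.symm) (e i) s t
  simpa only [Function.update_comp_equiv, Equiv.symm_symm] using this

/-- Two-sided Gaussian tail bound for functions which are Lipschitz in every coordinate. -/
lemma measureReal_pi_abs_sub_integral_ge_le {ι : Type*} [Fintype ι] [DecidableEq ι] {B : ℝ}
    {F : (ι → ℝ) → ℝ} {c : ι → ℝ} (hFm : Measurable F) (hB : ∀ x, |F x| ≤ B)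
    (hF : ∀ x i s t, |F (Function.update x i s) - F (Function.update x i t)| ≤ c i * |s - t|)
    {V ε : ℝ} (hV : 0 < V) (hcV : ∑ i, c i ^ 2 ≤ V) (hε : 0 < ε) :
    (Measure.pi fun _ => gaussianReal 0 1).real
      {x | ε ≤ |F x - ∫ y, F y ∂(Measure.pi fun _ => gaussianReal 0 1)|}
      ≤ 2 * exp (-(ε ^ 2 / (4 * V))) := by
  set ρ := Measure.pi fun _ : ι => gaussianReal 0 1 with hρ
  have hone : ∀ G : (ι → ℝ) → ℝ, Measurable G → (∀ x, |G x| ≤ B) →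
      (∀ x i s t, |G (Function.update x i s) - G (Function.update x i t)| ≤ c i * |s - t|) →
      ρ.real {x | ε ≤ G x - ∫ y, G y ∂ρ} ≤ exp (-(ε ^ 2 / (4 * V))) := by
    intro G hG hGB hGc
    set l := ε / (2 * V) with hl
    have hl0 : 0 < l := by positivity
    have hint : Integrable (fun x => exp (l * (G x - ∫ y, G y ∂ρ))) ρ := by
      refine Integrable.of_bound (by fun_prop) (exp (l * (B - ∫ y, G y ∂ρ))) (ae_of_all _ fun x => ?_)
      rw [norm_eq_abs, abs_of_pos (exp_pos _)]
      exact exp_le_exp.2 (mul_le_mul_of_nonneg_left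
        (sub_le_sub_right ((le_abs_self _).trans (hGB _)) _) hl0.le)
    have hmgf : mgf (fun x => G x - ∫ y, G y ∂ρ) ρ l ≤ exp (l ^ 2 * V) := by
      have := integral_exp_sub_integral_pi_le (F := fun x => l * G x) (c := fun i => l * c i)
        (B := l * B) (by fun_prop)
        (fun x => by rw [abs_mul, abs_of_pos hl0]; exact mul_le_mul_of_nonneg_left (hGB x) hl0.le)
        (fun x i s t => by
          rw [← mul_sub, abs_mul, abs_of_pos hl0, mul_assoc]
          exact mul_le_mul_of_nonneg_left (hGc x i s t) hl0.le)
      rw [integral_const_mul] at this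
      simp_rw [← mul_sub, mul_pow, ← Finset.mul_sum] at this
      exact this.trans (exp_le_exp.2 (by gcongr))
    calc ρ.real {x | ε ≤ G x - ∫ y, G y ∂ρ}
        ≤ exp (-l * ε) * mgf (fun x => G x - ∫ y, G y ∂ρ) ρ l :=
          measure_ge_le_exp_mul_mgf ε hl0.le hint
      _ ≤ exp (-l * ε) * exp (l ^ 2 * V) := by gcongr
      _ = exp (-(ε ^ 2 / (4 * V))) := by
          rw [← exp_add]; congr 1; rw [hl]; field_simp; ring
  have h1 := hone F hFm hB hF
  have h2 := hone (fun x => -F x) hFm.neg (by simpa using hB) (fun x i s t => by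
    rw [← abs_neg]; convert hF x i s t using 2; ring)
  rw [integral_neg] at h2
  calc ρ.real {x | ε ≤ |F x - ∫ y, F y ∂ρ|}
      ≤ ρ.real ({x | ε ≤ F x - ∫ y, F y ∂ρ} ∪ {x | ε ≤ -F x - -∫ y, F y ∂ρ}) := by
        refine measureReal_mono fun x hx => ?_
        rcases le_abs.1 (show ε ≤ |_| from hx) with h | h
        · exact Or.inl h
        · right; rw [Set.mem_ofPred_eq]; linarith
    _ ≤ _ := (measureReal_union_le _ _).trans (by linarith)


lemma map_sphereUniform (ι : Type) [Fintype ι] (r : ℝ)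
    (e : EuclideanSpace ℝ ι ≃ₗᵢ[ℝ] EuclideanSpace ℝ ι) :
    (sphereUniform ι r).map e = sphereUniform ι r := by
  unfold sphereUniform
  rw [Measure.map_smul]
  congr 1
  have h := (IsometryEquiv.measurePreserving_hausdorffMeasure e.toIsometryEquiv
    ((Fintype.card ι - 1 : ℕ) : ℝ)).restrict_preimage
      (s := Metric.sphere (0 : EuclideanSpace ℝ ι) r) Metric.isClosed_sphere.measurableSet
  have hs : e.toIsometryEquiv ⁻¹' Metric.sphere (0 : EuclideanSpace ℝ ι) r = Metric.sphere 0 r := by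
    ext x; simp
  rw [hs] at h
  exact h.map_eq

lemma ae_norm_eq_sphereUniform (ι : Type) [Fintype ι] (r : ℝ) :
    ∀ᵐ w ∂(sphereUniform ι r), ‖w‖ = r := by
  refine Measure.ae_smul_measure ?_ _
  filter_upwards [ae_restrict_mem Metric.isClosed_sphere.measurableSet] with w hw
  simpa using hw

section RotationInvariant

variable {ι : Type*} [Fintype ι] {ν : Measure (EuclideanSpace ℝ ι)}

/-- Integrals of functions of `⟪u, w⟫` against a rotation-invariant measure only depend on `‖u‖`. -/
lemma integral_inner_eq_of_norm_eq {G : Type*} [NormedAddCommGroup G] [NormedSpace ℝ G]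
    (hinv : ∀ e : EuclideanSpace ℝ ι ≃ₗᵢ[ℝ] EuclideanSpace ℝ ι, ν.map e = ν)
    (g : ℝ → G) {u v : EuclideanSpace ℝ ι} (h : ‖u‖ = ‖v‖) :
    ∫ w, g (inner ℝ w u) ∂ν = ∫ w, g (inner ℝ w v) ∂ν := by
  set e := (Submodule.span ℝ {u - v})ᗮ.reflection with he
  have heu : e u = v := Submodule.reflection_sub h
  have hmp : MeasurePreserving e.toHomeomorph.toMeasurableEquiv ν ν :=
    ⟨e.continuous.measurable, hinv e⟩
  rw [← heu, ← hmp.integral_comp' fun w => g (inner ℝ w (e u))]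
  refine integral_congr_ae (ae_of_all _ fun w => ?_)
  change g _ = g (inner ℝ (e w) (e u))
  rw [e.inner_map_map]

lemma integral_inner_eq_zero
    (hinv : ∀ e : EuclideanSpace ℝ ι ≃ₗᵢ[ℝ] EuclideanSpace ℝ ι, ν.map e = ν)
    (u : EuclideanSpace ℝ ι) : ∫ w, inner ℝ w u ∂ν = 0 := by
  have := integral_inner_eq_of_norm_eq hinv (fun x : ℝ => x) (u := u) (v := -u) (by simp)
  simp only [inner_neg_right, integral_neg] at this
  linarith

variable [Nonempty ι] [IsProbabilityMeasure ν]

lemma integral_inner_sq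
    (hinv : ∀ e : EuclideanSpace ℝ ι ≃ₗᵢ[ℝ] EuclideanSpace ℝ ι, ν.map e = ν)
    (hnorm : ∀ᵐ w ∂ν, ‖w‖ = √(Fintype.card ι)) (u : EuclideanSpace ℝ ι) :
    Integrable (fun w => inner ℝ w u ^ 2) ν ∧ ∫ w, inner ℝ w u ^ 2 ∂ν = ‖u‖ ^ 2 := by
  classical
  have hint : ∀ u, Integrable (fun w : EuclideanSpace ℝ ι => inner ℝ w u ^ 2) ν := fun u => by
    refine Integrable.of_bound (by fun_prop) ((√(Fintype.card ι) * ‖u‖) ^ 2) ?_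
    filter_upwards [hnorm] with w hw
    rw [norm_eq_abs, abs_pow, ← hw]
    gcongr
    exact abs_real_inner_le_norm w u
  refine ⟨hint u, ?_⟩
  have hbasis : ∀ a, ∫ w, inner ℝ w u ^ 2 ∂ν
      = ‖u‖ ^ 2 * ∫ w, inner ℝ w (EuclideanSpace.single a (1 : ℝ)) ^ 2 ∂ν := by
    intro a
    rw [integral_inner_eq_of_norm_eq hinv (fun x => x ^ 2) (u := u)
      (v := ‖u‖ • EuclideanSpace.single a (1 : ℝ)) (by simp [norm_smul]), ← integral_const_mul]
    simp_rw [inner_smul_right, mul_pow]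
  have hsum : ∑ a, ∫ w, inner ℝ w (EuclideanSpace.single a (1 : ℝ)) ^ 2 ∂ν = Fintype.card ι := by
    rw [← integral_finsetSum _ fun a _ => hint _]
    have : ∀ᵐ w ∂ν, ∑ a, inner ℝ w (EuclideanSpace.single a (1 : ℝ)) ^ 2 = (Fintype.card ι : ℝ) := by
      filter_upwards [hnorm] with w hw
      have h2 := EuclideanSpace.real_norm_sq_eq w
      rw [hw, sq_sqrt (Nat.cast_nonneg _)] at h2
      simp [h2, EuclideanSpace.inner_single_right]
    rw [integral_congr_ae this]; simp
  have hn : (Fintype.card ι : ℝ) ≠ 0 := by simp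
  have : (Fintype.card ι : ℝ) * ∫ w, inner ℝ w u ^ 2 ∂ν = Fintype.card ι * ‖u‖ ^ 2 := by
    calc _ = ∑ _a : ι, ∫ w, inner ℝ w u ^ 2 ∂ν := by simp
      _ = ∑ a, ‖u‖ ^ 2 * ∫ w, inner ℝ w (EuclideanSpace.single a (1 : ℝ)) ^ 2 ∂ν :=
          Finset.sum_congr rfl fun a _ => hbasis a
      _ = _ := by rw [← Finset.mul_sum, hsum, mul_comm]
  exact mul_left_cancel₀ hn this

/-- Multiplying a rotation-invariant vector on the sphere of radius `√n` by an independent copy of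
the normalized length of a standard Gaussian vector gives a standard Gaussian vector. -/
lemma map_norm_smul_eq_stdGaussian
    (hinv : ∀ e : EuclideanSpace ℝ ι ≃ₗᵢ[ℝ] EuclideanSpace ℝ ι, ν.map e = ν)
    (hnorm : ∀ᵐ w ∂ν, ‖w‖ = √(Fintype.card ι)) :
    ((stdGaussian (EuclideanSpace ℝ ι)).prod ν).map
      (fun p => (‖p.1‖ / √(Fintype.card ι)) • p.2) = stdGaussian (EuclideanSpace ℝ ι) := by
  set γ := stdGaussian (EuclideanSpace ℝ ι) with hγ
  have hmeas : Measurable fun p : EuclideanSpace ℝ ι × EuclideanSpace ℝ ι =>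
      (‖p.1‖ / √(Fintype.card ι)) • p.2 := by fun_prop
  have : IsProbabilityMeasure ((γ.prod ν).map
      (fun p => (‖p.1‖ / √(Fintype.card ι)) • p.2)) :=
    Measure.isProbabilityMeasure_map hmeas.aemeasurable
  have hn : 0 < √(Fintype.card ι) := by simp [Fintype.card_pos]
  refine Measure.ext_of_charFun (funext fun v => ?_)
  rw [charFun_apply, integral_map hmeas.aemeasurable (by fun_prop), charFun_stdGaussian]
  have hint : ∀ h : EuclideanSpace ℝ ι → EuclideanSpace ℝ ι → ℝ,
      Measurable (fun p : EuclideanSpace ℝ ι × EuclideanSpace ℝ ι => h p.1 p.2) →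
      Integrable (fun p : EuclideanSpace ℝ ι × EuclideanSpace ℝ ι =>
        Complex.exp ((h p.1 p.2 : ℂ) * Complex.I)) (γ.prod ν) := by
    intro h hh
    refine Integrable.of_bound (by fun_prop) 1 (ae_of_all _ fun p => ?_)
    rw [Complex.norm_exp_ofReal_mul_I]
  rw [integral_prod _ (hint (fun g w => inner ℝ ((‖g‖ / √(Fintype.card ι)) • w) v) (by fun_prop))]
  set s := ‖v‖ / √(Fintype.card ι) with hs
  have hrot : ∀ g : EuclideanSpace ℝ ι,
      ∫ w, Complex.exp ((inner ℝ ((‖g‖ / √(Fintype.card ι)) • w) v : ℝ) * Complex.I) ∂ν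
      = ∫ w, Complex.exp ((inner ℝ w (s • g) : ℝ) * Complex.I) ∂ν := by
    intro g
    simp_rw [real_inner_smul_left, ← real_inner_smul_right _ v]
    refine integral_inner_eq_of_norm_eq hinv (fun x : ℝ => Complex.exp (x * Complex.I)) ?_
    rw [norm_smul, norm_smul, hs, norm_of_nonneg (by positivity), norm_of_nonneg (by positivity)]
    ring
  simp_rw [hrot]
  rw [integral_integral_swap (hint (fun g w => inner ℝ w (s • g)) (by fun_prop))]
  have hin : ∀ᵐ w ∂ν, ∫ g, Complex.exp ((inner ℝ w (s • g) : ℝ) * Complex.I) ∂γ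
      = Complex.exp (-(‖v‖ : ℂ) ^ 2 / 2) := by
    filter_upwards [hnorm] with w hw
    have h1 := charFun_stdGaussian (s • w)
    rw [charFun_apply] at h1
    have h2 : ∀ g : EuclideanSpace ℝ ι, inner ℝ w (s • g) = inner ℝ g (s • w) := fun g => by
      rw [real_inner_smul_right, real_inner_smul_right, real_inner_comm]
    simp_rw [h2]
    have h3 : ‖s • w‖ = ‖v‖ := by
      rw [norm_smul, hw, hs, norm_of_nonneg (by positivity), div_mul_cancel₀ _ hn.ne']
    rw [hγ, h1, h3]
  rw [integral_congr_ae hin]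
  simp

end RotationInvariant

lemma integral_inner_stdGaussian {ι : Type*} [Fintype ι] {u : EuclideanSpace ℝ ι} (hu : ‖u‖ = 1)
    {f : ℝ → ℝ} (hf : Measurable f) :
    ∫ g, f (inner ℝ g u) ∂(stdGaussian (EuclideanSpace ℝ ι)) = ∫ x, f x ∂(gaussianReal 0 1) := by
  have hmap : (stdGaussian (EuclideanSpace ℝ ι)).map (fun g => inner ℝ g u) = gaussianReal 0 1 := by
    have hm : Measurable fun g : EuclideanSpace ℝ ι => inner ℝ g u := by fun_prop
    have := Measure.isProbabilityMeasure_map (μ := stdGaussian (EuclideanSpace ℝ ι)) hm.aemeasurable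
    refine Measure.ext_of_charFun (funext fun t => ?_)
    rw [charFun_apply, integral_map hm.aemeasurable (by fun_prop), charFun_gaussianReal]
    have h := charFun_stdGaussian (t • u)
    rw [charFun_apply] at h
    simp only [inner_smul_right, norm_smul, hu] at h
    simp only [RCLike.inner_apply, conj_trivial]
    rw [h]
    simp [← Complex.ofReal_pow, neg_div]
  rw [← hmap, integral_map (by fun_prop) hf.aestronglyMeasurable]

lemma integral_norm_div_sqrt_sub_one_sq_le (ι : Type*) [Fintype ι] [Nonempty ι] :
    Integrable (fun g : EuclideanSpace ℝ ι => (‖g‖ / √(Fintype.card ι) - 1) ^ 2) (stdGaussian _) ∧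
    ∫ g : EuclideanSpace ℝ ι, (‖g‖ / √(Fintype.card ι) - 1) ^ 2 ∂(stdGaussian _)
      ≤ Var[fun x => x ^ 2; gaussianReal 0 1] / Fintype.card ι := by
  set γ := gaussianReal 0 1 with hγ
  set n := (Fintype.card ι : ℝ) with hn
  have hn0 : 0 < n := by simp [hn, Fintype.card_pos]
  have hL2 : MemLp (fun x : ℝ => x ^ 2) 2 γ := by
    have h4 : MemLp (fun x : ℝ => x) 4 γ := memLp_id_gaussianReal' 4 (by simp)
    refine (memLp_two_iff_integrable_sq (by fun_prop)).2 ?_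
    have := h4.integrable_norm_pow (by simp)
    refine this.congr (ae_of_all _ fun x => ?_)
    simp only [norm_eq_abs]
    norm_num [← pow_mul, Even.pow_abs]
  have hE : ∫ x, x ^ 2 ∂γ = 1 := by
    have h1 := variance_eq_sub (μ := γ) (X := fun x : ℝ => x) (memLp_id_gaussianReal' 2 (by simp))
    have h2 : Var[fun x : ℝ => x; γ] = 1 := by simp [hγ]
    have h3 : ∫ x, x ∂γ = 0 := by simp [hγ]
    rw [h2, h3] at h1
    simpa using h1.symm
  set ρ := Measure.pi fun _ : ι => γ with hρ
  have hmemi : ∀ i : ι, MemLp (fun x : ι → ℝ => x i ^ 2) 2 ρ := fun i =>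
    hL2.comp_measurePreserving (measurePreserving_eval (fun _ : ι => γ) i)
  have hmean : ∫ x, ∑ i, x i ^ 2 ∂ρ = n := by
    rw [integral_finsetSum _ fun i _ => (hmemi i).integrable (by simp)]
    have : ∀ i : ι, ∫ x, x i ^ 2 ∂ρ = 1 := fun i => by
      rw [hρ, integral_comp_eval (μ := fun _ : ι => γ) (f := fun x : ℝ => x ^ 2) (by fun_prop), hE]
    simp [this, hn]
  have hvar : Var[fun x => ∑ i, x i ^ 2; ρ] = n * Var[fun x => x ^ 2; γ] := by
    have := variance_sum_pi (μ := fun _ : ι => γ) (X := fun _ x => x ^ 2) (fun _ => hL2)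
    have he : (∑ i, fun ω : ι → ℝ => ω i ^ 2) = fun x => ∑ i, x i ^ 2 := by
      ext x; simp
    simpa [he, hn] using this
  have hmemS : MemLp (fun x : ι → ℝ => ∑ i, x i ^ 2) 2 ρ := by
    have := memLp_finsetSum' Finset.univ (fun i _ => hmemi i)
    convert this using 1
    ext x; simp
  have hcent : Integrable (fun x : ι → ℝ => ((∑ i, x i ^ 2 - n) / n) ^ 2) ρ := by
    have := (hmemS.sub (memLp_const n)).integrable_sq
    simp_rw [div_pow]
    exact this.div_const _
  have hval : ∫ x : ι → ℝ, ((∑ i, x i ^ 2 - n) / n) ^ 2 ∂ρ = Var[fun x => x ^ 2; γ] / n := by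
    simp_rw [div_pow]
    rw [integral_div, ← hmean, ← variance_eq_integral hmemS.aestronglyMeasurable.aemeasurable, hvar, hmean]
    field_simp
  have hle : ∀ x : ι → ℝ, (‖WithLp.toLp 2 x‖ / √n - 1) ^ 2 ≤ ((∑ i, x i ^ 2 - n) / n) ^ 2 := by
    intro x
    set R := ‖WithLp.toLp 2 x‖ / √n with hR
    have hR0 : 0 ≤ R := by positivity
    have hR2 : (∑ i, x i ^ 2 - n) / n = (R - 1) * (R + 1) := by
      have : R ^ 2 = (∑ i, x i ^ 2) / n := by
        rw [hR, div_pow, sq_sqrt hn0.le, EuclideanSpace.real_norm_sq_eq]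
      field_simp
      field_simp at this
      linarith
    rw [hR2, mul_pow]
    nlinarith [mul_nonneg (sq_nonneg (R - 1)) hR0, mul_nonneg (sq_nonneg (R - 1)) (sq_nonneg R)]
  have hdom : Integrable (fun x : ι → ℝ => (‖WithLp.toLp 2 x‖ / √n - 1) ^ 2) ρ := by
    refine hcent.mono' (by fun_prop) (ae_of_all _ fun x => ?_)
    rw [norm_of_nonneg (sq_nonneg _)]
    exact hle x
  rw [← map_pi_eq_stdGaussian]
  refine ⟨(integrable_map_measure (by fun_prop) (by fun_prop)).2 hdom, ?_⟩
  rw [integral_map (by fun_prop) (by fun_prop)]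
  exact (integral_mono hdom hcent hle).trans_eq hval

/-- The average of `f` over the projections of `w` in the directions `u s`, `s ∈ S`. -/
noncomputable def projAvg {ι κ : Type*} [Fintype ι] (S : Finset κ) (u : κ → EuclideanSpace ℝ ι)
    (f : ℝ → ℝ) (w : EuclideanSpace ℝ ι) : ℝ :=
  (S.card : ℝ)⁻¹ * ∑ s ∈ S, f (inner ℝ w (u s))

section ProjAvg

variable {ι κ : Type*} [Fintype ι] {S : Finset κ} {u : κ → EuclideanSpace ℝ ι} {f : ℝ → ℝ}
  {K B : ℝ}

lemma measurable_projAvg (hf : Measurable f) : Measurable (projAvg S u f) := by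
  unfold projAvg
  refine Measurable.const_mul (Finset.measurable_sum _ fun s _ => hf.comp ?_) _
  fun_prop

lemma abs_projAvg_le (hS : S.Nonempty) (hB : ∀ x, |f x| ≤ B) (w : EuclideanSpace ℝ ι) :
    |projAvg S u f w| ≤ B := by
  have hc : (0 : ℝ) < S.card := by exact_mod_cast hS.card_pos
  rw [projAvg, abs_mul, abs_of_pos (inv_pos.2 hc), inv_mul_le_iff₀ hc]
  exact (Finset.abs_sum_le_sum_abs _ _).trans
    ((Finset.sum_le_sum fun s _ => hB _).trans_eq (by simp))

lemma abs_projAvg_sub_le (hf : ∀ x y, |f x - f y| ≤ K * |x - y|) (v w : EuclideanSpace ℝ ι) :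
    |projAvg S u f v - projAvg S u f w|
      ≤ K * ((S.card : ℝ)⁻¹ * ∑ s ∈ S, |inner ℝ (v - w) (u s)|) := by
  rw [projAvg, projAvg, ← mul_sub, ← Finset.sum_sub_distrib, abs_mul, abs_of_nonneg (by positivity),
    mul_left_comm]
  gcongr
  rw [Finset.mul_sum]
  refine (Finset.abs_sum_le_sum_abs _ _).trans (Finset.sum_le_sum fun s _ => ?_)
  rw [inner_sub_left]
  exact hf _ _

lemma measureReal_stdGaussian_projAvg_le (hS : S.Nonempty) (hu : ∀ s ∈ S, ‖u s‖ = 1)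
    (hfm : Measurable f) (hB : ∀ x, |f x| ≤ B) (hf : ∀ x y, |f x - f y| ≤ K * |x - y|)
    {V ε : ℝ} (hV : 0 < V)
    (hcV : ∑ a, (K * ((S.card : ℝ)⁻¹ * ∑ s ∈ S, |u s a|)) ^ 2 ≤ V) (hε : 0 < ε) :
    (stdGaussian (EuclideanSpace ℝ ι)).real
      {w | ε ≤ |projAvg S u f w - ∫ x, f x ∂(gaussianReal 0 1)|} ≤ 2 * exp (-(ε ^ 2 / (4 * V))) := by
  classical
  set γ := stdGaussian (EuclideanSpace ℝ ι) with hγ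
  have hc : (S.card : ℝ) ≠ 0 := by exact_mod_cast hS.card_pos.ne'
  have hFm : Measurable (projAvg S u f) := measurable_projAvg hfm
  have hmean : ∫ w, projAvg S u f w ∂γ = ∫ x, f x ∂(gaussianReal 0 1) := by
    simp only [projAvg]
    have hint : ∀ s ∈ S, Integrable (fun w => f (inner ℝ w (u s))) γ := fun s _ =>
      Integrable.of_bound (hfm.comp (g := f) (by fun_prop)).aestronglyMeasurable B
        (ae_of_all _ fun w => hB _)
    rw [integral_const_mul, integral_finsetSum _ hint]
    rw [Finset.sum_congr rfl fun s hs => integral_inner_stdGaussian (hu s hs) hfm]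
    simp [hc]
  have htail := measureReal_pi_abs_sub_integral_ge_le (F := fun x => projAvg S u f (WithLp.toLp 2 x))
    (c := fun a => K * ((S.card : ℝ)⁻¹ * ∑ s ∈ S, |u s a|)) (B := B) (hFm.comp (by fun_prop))
    (fun x => abs_projAvg_le hS hB _) (fun x i s t => by
      refine (abs_projAvg_sub_le hf _ _).trans_eq ?_
      have hd : WithLp.toLp 2 (Function.update x i s) - WithLp.toLp 2 (Function.update x i t)
          = EuclideanSpace.single i (s - t) := by
        ext j
        by_cases h : j = i
        · subst h; simp
        · simp [h]
      rw [hd]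
      simp only [EuclideanSpace.inner_single_left, abs_mul, conj_trivial, ← Finset.mul_sum]
      ring) hV hcV hε
  have hmap : ∫ x, projAvg S u f (WithLp.toLp 2 x) ∂(Measure.pi fun _ : ι => gaussianReal 0 1)
      = ∫ x, f x ∂(gaussianReal 0 1) := by
    rw [← hmean, hγ, ← map_pi_eq_stdGaussian, integral_map (by fun_prop) hFm.aestronglyMeasurable]
  rw [hmap] at htail
  rw [hγ, ← map_pi_eq_stdGaussian, map_measureReal_apply (by fun_prop)
    (measurableSet_le measurable_const (hFm.sub_const _).abs)]
  exact htail

/-- Tail bound for averages over projections of a vector with a rotation-invariant distribution on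
the sphere of radius `√n`. -/
lemma measureReal_projAvg_le [Nonempty ι] {ν : Measure (EuclideanSpace ℝ ι)} [IsProbabilityMeasure ν]
    (hinv : ∀ e : EuclideanSpace ℝ ι ≃ₗᵢ[ℝ] EuclideanSpace ℝ ι, ν.map e = ν)
    (hnorm : ∀ᵐ w ∂ν, ‖w‖ = √(Fintype.card ι))
    (hS : S.Nonempty) (hu : ∀ s ∈ S, ‖u s‖ = 1)
    (hfm : Measurable f) (hB : ∀ x, |f x| ≤ B) (hf : ∀ x y, |f x - f y| ≤ K * |x - y|)
    {V ε : ℝ} (hV : 0 < V)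
    (hcV : ∑ a, (K * ((S.card : ℝ)⁻¹ * ∑ s ∈ S, |u s a|)) ^ 2 ≤ V) (hε : 0 < ε) :
    ν.real {w | 2 * ε ≤ |projAvg S u f w - ∫ x, f x ∂(gaussianReal 0 1)|}
      ≤ 2 * exp (-(ε ^ 2 / (4 * V)))
        + K ^ 2 * (Var[fun x => x ^ 2; gaussianReal 0 1] / Fintype.card ι) / ε ^ 2 := by
  set γ := stdGaussian (EuclideanSpace ℝ ι) with hγ
  set F := projAvg S u f with hF
  set m := ∫ x, f x ∂(gaussianReal 0 1) with hm
  set R : EuclideanSpace ℝ ι → ℝ := fun g => ‖g‖ / √(Fintype.card ι) with hR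
  have hFm : Measurable F := measurable_projAvg hfm
  have hRm : Measurable R := by fun_prop
  have hc : (0 : ℝ) < S.card := by exact_mod_cast hS.card_pos
  set T : EuclideanSpace ℝ ι × EuclideanSpace ℝ ι → EuclideanSpace ℝ ι := fun p => R p.1 • p.2 with hT
  have hTm : Measurable T := by fun_prop
  have hTmap : (γ.prod ν).map T = γ := map_norm_smul_eq_stdGaussian hinv hnorm
  have hset : MeasurableSet {w | ε ≤ |F w - m|} :=
    measurableSet_le measurable_const (hFm.sub_const _).abs
  have hset2 : MeasurableSet {w | 2 * ε ≤ |F w - m|} :=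
    measurableSet_le measurable_const (hFm.sub_const _).abs
  have hsnd : ν.real {w | 2 * ε ≤ |F w - m|} = (γ.prod ν).real {p | 2 * ε ≤ |F p.2 - m|} := by
    conv_lhs => rw [← (measurePreserving_snd (μ := γ) (ν := ν)).map_eq]
    rw [map_measureReal_apply measurable_snd hset2]
    rfl
  have hfst : (γ.prod ν).real {p | ε ≤ |F (T p) - m|} ≤ 2 * exp (-(ε ^ 2 / (4 * V))) := by
    have := measureReal_stdGaussian_projAvg_le hS hu hfm hB hf hV hcV hε
    rw [← hγ, ← hTmap, map_measureReal_apply hTm hset] at this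
    exact this
  set A : EuclideanSpace ℝ ι → ℝ := fun w => (S.card : ℝ)⁻¹ * ∑ s ∈ S, inner ℝ w (u s) ^ 2 with hA
  have hAi : Integrable A ν := by
    refine Integrable.const_mul (integrable_finsetSum _ fun s _ => ?_) _
    exact (integral_inner_sq hinv hnorm (u s)).1
  have hAv : ∫ w, A w ∂ν = 1 := by
    rw [hA, integral_const_mul,
      integral_finsetSum _ fun s _ => (integral_inner_sq hinv hnorm (u s)).1,
      Finset.sum_congr rfl fun s hs => (integral_inner_sq hinv hnorm (u s)).2.trans
        (by rw [hu s hs, one_pow])]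
    simp [hc.ne']
  obtain ⟨hRi, hRv⟩ := integral_norm_div_sqrt_sub_one_sq_le ι
  have hdiff : ∀ p : EuclideanSpace ℝ ι × EuclideanSpace ℝ ι,
      (F p.2 - F (T p)) ^ 2 ≤ K ^ 2 * ((R p.1 - 1) ^ 2 * A p.2) := by
    rintro ⟨g, w⟩
    have h1 := abs_projAvg_sub_le (S := S) (u := u) hf w (R g • w)
    have h2 : ∀ s, |inner ℝ (w - R g • w) (u s)| = |R g - 1| * |inner ℝ w (u s)| := by
      intro s
      rw [inner_sub_left, real_inner_smul_left, ← abs_mul, ← abs_neg]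
      congr 1; ring
    simp_rw [h2, ← Finset.mul_sum] at h1
    have h3 : ((S.card : ℝ)⁻¹ * ∑ s ∈ S, |inner ℝ w (u s)|) ^ 2 ≤ A w := by
      have := sq_sum_le_card_mul_sum_sq (s := S) (f := fun s => |inner ℝ w (u s)|)
      simp_rw [sq_abs] at this
      rw [mul_pow, hA]
      calc ((S.card : ℝ)⁻¹) ^ 2 * (∑ s ∈ S, |inner ℝ w (u s)|) ^ 2
          ≤ ((S.card : ℝ)⁻¹) ^ 2 * (S.card * ∑ s ∈ S, inner ℝ w (u s) ^ 2) := by gcongr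
        _ = _ := by field_simp
    calc (F w - F (R g • w)) ^ 2 = |F w - F (R g • w)| ^ 2 := (sq_abs _).symm
      _ ≤ (K * ((S.card : ℝ)⁻¹ * (|R g - 1| * ∑ s ∈ S, |inner ℝ w (u s)|))) ^ 2 := by gcongr
      _ = K ^ 2 * ((R g - 1) ^ 2 * ((S.card : ℝ)⁻¹ * ∑ s ∈ S, |inner ℝ w (u s)|) ^ 2) := by
          rw [← sq_abs (R g - 1)]; ring
      _ ≤ _ := by gcongr
  have hpi : Integrable (fun p : EuclideanSpace ℝ ι × EuclideanSpace ℝ ι =>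
      K ^ 2 * ((R p.1 - 1) ^ 2 * A p.2)) (γ.prod ν) := (hRi.mul_prod hAi).const_mul _
  have hmarkov : (γ.prod ν).real {p | ε ≤ |F p.2 - F (T p)|}
      ≤ K ^ 2 * (Var[fun x => x ^ 2; gaussianReal 0 1] / Fintype.card ι) / ε ^ 2 := by
    rw [le_div_iff₀' (by positivity)]
    calc ε ^ 2 * (γ.prod ν).real {p | ε ≤ |F p.2 - F (T p)|}
        ≤ ε ^ 2 * (γ.prod ν).real {p | ε ^ 2 ≤ K ^ 2 * ((R p.1 - 1) ^ 2 * A p.2)} := by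
          refine mul_le_mul_of_nonneg_left (measureReal_mono fun p hp => ?_) (sq_nonneg ε)
          have hp' : ε ≤ |F p.2 - F (T p)| := hp
          refine le_trans ?_ (hdiff p)
          rw [← sq_abs (F p.2 - F (T p))]
          gcongr
      _ ≤ ∫ p, K ^ 2 * ((R p.1 - 1) ^ 2 * A p.2) ∂(γ.prod ν) := by
          refine mul_meas_ge_le_integral_of_nonneg (ae_of_all _ fun p => ?_) hpi _
          exact (sq_nonneg _).trans (hdiff p)
      _ = K ^ 2 * ((∫ g, (R g - 1) ^ 2 ∂γ) * ∫ w, A w ∂ν) := by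
          rw [integral_const_mul, ← integral_prod_mul]
      _ ≤ _ := by
          rw [hAv, mul_one]
          gcongr
  rw [hsnd]
  calc (γ.prod ν).real {p | 2 * ε ≤ |F p.2 - m|}
      ≤ (γ.prod ν).real ({p | ε ≤ |F (T p) - m|} ∪ {p | ε ≤ |F p.2 - F (T p)|}) := by
        refine measureReal_mono fun p hp => ?_
        have hp' : 2 * ε ≤ |F p.2 - m| := hp
        by_contra hcon
        simp only [Set.mem_union, Set.mem_ofPred_eq, not_or, not_le] at hcon
        have := abs_sub_le (F p.2) (F (T p)) m
        linarith
    _ ≤ _ := (measureReal_union_le _ _).trans (add_le_add hfst hmarkov)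

end ProjAvg

lemma centralBinom_sq_mul_le (n : ℕ) : n.centralBinom ^ 2 * (2 * n + 1) ≤ 16 ^ n := by
  induction n with
  | zero => simp
  | succ n ih =>
    have h := Nat.succ_mul_centralBinom_succ n
    have h2 : (n + 1) ^ 2 * ((n + 1).centralBinom ^ 2 * (2 * (n + 1) + 1)) ≤
        (n + 1) ^ 2 * 16 ^ (n + 1) := by
      calc (n + 1) ^ 2 * ((n + 1).centralBinom ^ 2 * (2 * (n + 1) + 1))
          = ((n + 1) * (n + 1).centralBinom) ^ 2 * (2 * (n + 1) + 1) := by ring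
        _ = (n.centralBinom ^ 2 * (2 * n + 1)) * (4 * (2 * n + 1) * (2 * n + 3)) := by
            rw [h]; ring
        _ ≤ 16 ^ n * (16 * (n + 1) ^ 2) := by
            refine Nat.mul_le_mul ih ?_
            nlinarith
        _ = _ := by ring
    exact Nat.le_of_mul_le_mul_left h2 (by positivity)

lemma sixteen_pow_le_mul_centralBinom_sq (n : ℕ) : 16 ^ n ≤ (4 * n + 1) * n.centralBinom ^ 2 := by
  induction n with
  | zero => simp
  | succ n ih =>
    have h := Nat.succ_mul_centralBinom_succ n
    have h2 : (n + 1) ^ 2 * (4 * n + 1) * 16 ^ (n + 1) ≤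
        (n + 1) ^ 2 * (4 * n + 1) * ((4 * (n + 1) + 1) * (n + 1).centralBinom ^ 2) := by
      calc (n + 1) ^ 2 * (4 * n + 1) * 16 ^ (n + 1)
          = 16 ^ n * (16 * (n + 1) ^ 2 * (4 * n + 1)) := by ring
        _ ≤ ((4 * n + 1) * n.centralBinom ^ 2) * (4 * (2 * n + 1) ^ 2 * (4 * n + 5)) := by
            refine Nat.mul_le_mul ih ?_
            nlinarith
        _ = (4 * n + 1) * (4 * n + 5) * (2 * (2 * n + 1) * n.centralBinom) ^ 2 := by ring
        _ = _ := by rw [← h]; ring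
    exact Nat.le_of_mul_le_mul_left h2 (by positivity)

lemma add_choose_sq_mul_centralBinom (i j : ℕ) :
    (i + j).choose i ^ 2 * (i + j).centralBinom
      = (2 * i + 2 * j).choose (2 * i) * i.centralBinom * j.centralBinom := by
  have hc : ∀ n : ℕ, n.centralBinom * (n.factorial * n.factorial) = (2 * n).factorial := fun n => by
    have := Nat.add_choose_mul_factorial_mul_factorial n n
    rw [Nat.centralBinom, two_mul, ← this]; ring
  have h1 := Nat.add_choose_mul_factorial_mul_factorial i j
  have h2 := Nat.add_choose_mul_factorial_mul_factorial (2 * i) (2 * j)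
  rw [← Nat.choose_symm_add] at h1 h2
  have h3 := hc (i + j)
  rw [← h1, mul_add, ← h2, ← hc i, ← hc j] at h3
  have hpos : 0 < (i.factorial * j.factorial) ^ 2 := by positivity
  refine Nat.eq_of_mul_eq_mul_right hpos ?_
  calc _ = (i + j).centralBinom * ((i + j).choose i * i.factorial * j.factorial *
        ((i + j).choose i * i.factorial * j.factorial)) := by ring
    _ = _ := by rw [h3]; ring

lemma two_mul_add_two_choose_mul (i j : ℕ) :
    (2 * (i + j) + 2).choose (2 * i + 1) * ((2 * i + 1) * (2 * j + 1))
      = (2 * (i + j)).choose (2 * i) * ((2 * (i + j) + 1) * (2 * (i + j) + 2)) := by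
  have h1 := Nat.add_one_mul_choose_eq (2 * (i + j) + 1) (2 * i)
  have h2 := Nat.choose_mul_succ_eq (2 * (i + j)) (2 * i)
  have h3 : 2 * (i + j) + 1 - 2 * i = 2 * j + 1 := by omega
  rw [h3] at h2
  calc (2 * (i + j) + 2).choose (2 * i + 1) * ((2 * i + 1) * (2 * j + 1))
      = ((2 * (i + j) + 1 + 1).choose (2 * i + 1) * (2 * i + 1)) * (2 * j + 1) := by ring
    _ = (2 * (i + j) + 2) * ((2 * (i + j) + 1).choose (2 * i) * (2 * j + 1)) := by rw [← h1]; ring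
    _ = _ := by rw [← h2]; ring

lemma choose_pow_four_mul_le (k i : ℕ) :
    k.choose i ^ 4 * (k + 1) ≤ (2 * k).choose (2 * i) * (2 * k + 2).choose (2 * i + 1) := by
  rcases lt_or_ge k i with hlt | hle
  · simp [Nat.choose_eq_zero_of_lt hlt]
  obtain ⟨j, rfl⟩ := Nat.exists_eq_add_of_le hle
  have hA := add_choose_sq_mul_centralBinom i j
  rw [← mul_add] at hA
  have hX := two_mul_add_two_choose_mul i j
  have hi := centralBinom_sq_mul_le i
  have hj := centralBinom_sq_mul_le j
  have hk := sixteen_pow_le_mul_centralBinom_sq (i + j)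
  set A := (i + j).choose i
  set X := (2 * (i + j)).choose (2 * i) with hXd
  set Y := (2 * (i + j) + 2).choose (2 * i + 1)
  set c := (i + j).centralBinom
  have hXpos : 0 < X := Nat.choose_pos (by omega)
  have hcpos : 0 < c := Nat.centralBinom_pos _
  have h1 : A ^ 4 * ((2 * i + 1) * (2 * j + 1)) ≤ X ^ 2 * (4 * (i + j) + 1) := by
    refine Nat.le_of_mul_le_mul_right (c := c ^ 2) ?_ (by positivity)
    calc A ^ 4 * ((2 * i + 1) * (2 * j + 1)) * c ^ 2
        = (A ^ 2 * c) ^ 2 * ((2 * i + 1) * (2 * j + 1)) := by ring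
      _ = X ^ 2 * ((i.centralBinom ^ 2 * (2 * i + 1)) * (j.centralBinom ^ 2 * (2 * j + 1))) := by
          rw [hA]; ring
      _ ≤ X ^ 2 * (16 ^ i * 16 ^ j) := by gcongr
      _ = X ^ 2 * 16 ^ (i + j) := by rw [pow_add]
      _ ≤ X ^ 2 * ((4 * (i + j) + 1) * c ^ 2) := by gcongr
      _ = _ := by ring
  refine Nat.le_of_mul_le_mul_right
    (c := X * ((2 * i + 1) * (2 * j + 1)) * (4 * (i + j) + 1)) ?_ (by positivity)
  calc A ^ 4 * (i + j + 1) * (X * ((2 * i + 1) * (2 * j + 1)) * (4 * (i + j) + 1))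
      = (A ^ 4 * ((2 * i + 1) * (2 * j + 1))) * (X * ((4 * (i + j) + 1) * (i + j + 1))) := by ring
    _ ≤ (X ^ 2 * (4 * (i + j) + 1)) * (X * ((2 * (i + j) + 1) * (2 * (i + j) + 2))) := by
        gcongr ?_ * (X * ?_)
        nlinarith
    _ = (X ^ 2 * (4 * (i + j) + 1)) * (Y * ((2 * i + 1) * (2 * j + 1))) := by rw [hX]
    _ = _ := by ring

lemma sum_choose_sq_mul_choose_sq_mul_sqrt_le (k l n : ℕ) :
    ∑ p ∈ Finset.HasAntidiagonal.antidiagonal n, ((k.choose p.1 * l.choose p.2 : ℕ) : ℝ) ^ 2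
      ≤ (2 * (k + l) + 2).choose (2 * n + 1) / √((k + 1) * (l + 1)) := by
  have hvand : ∀ a b : ℕ, ∀ e e' : ℕ, e + e' = 1 →
      ∑ p ∈ Finset.HasAntidiagonal.antidiagonal n, a.choose (2 * p.1 + e) * b.choose (2 * p.2 + e')
        ≤ (a + b).choose (2 * n + 1) := by
    intro a b e e' hee
    rw [Nat.add_choose_eq]
    have hinj : Set.InjOn (fun p : ℕ × ℕ => (2 * p.1 + e, 2 * p.2 + e'))
        (Finset.HasAntidiagonal.antidiagonal n : Set (ℕ × ℕ)) := by
      rintro ⟨a, b⟩ _ ⟨c, d⟩ _ h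
      simp only [Prod.mk.injEq] at h ⊢
      omega
    rw [← Finset.sum_image (g := fun p : ℕ × ℕ => (2 * p.1 + e, 2 * p.2 + e'))
      (f := fun p : ℕ × ℕ => a.choose p.1 * b.choose p.2) hinj]
    refine Finset.sum_le_sum_of_subset fun p hp => ?_
    simp only [Finset.mem_image, Finset.HasAntidiagonal.mem_antidiagonal] at hp ⊢
    obtain ⟨q, hq, rfl⟩ := hp
    simp only
    omega
  have h1 := hvand (2 * k) (2 * l + 2) 0 1 rfl
  have h2 := hvand (2 * k + 2) (2 * l) 1 0 rfl
  rw [show 2 * k + (2 * l + 2) = 2 * (k + l) + 2 by ring] at h1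
  rw [show 2 * k + 2 + 2 * l = 2 * (k + l) + 2 by ring] at h2
  rw [le_div_iff₀ (by positivity), Finset.sum_mul]
  have hterm : ∀ p ∈ Finset.HasAntidiagonal.antidiagonal n,
      ((k.choose p.1 * l.choose p.2 : ℕ) : ℝ) ^ 2 * √((k + 1) * (l + 1))
        ≤ (((2 * k).choose (2 * p.1 + 0) * (2 * l + 2).choose (2 * p.2 + 1) : ℕ)
          + ((2 * k + 2).choose (2 * p.1 + 1) * (2 * l).choose (2 * p.2 + 0) : ℕ) : ℝ) / 2 := by
    intro p _
    have hx : ((k.choose p.1 : ℝ)) ^ 4 * (k + 1) ≤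
        (2 * k).choose (2 * p.1) * (2 * k + 2).choose (2 * p.1 + 1) := by
      exact_mod_cast choose_pow_four_mul_le k p.1
    have hy : ((l.choose p.2 : ℝ)) ^ 4 * (l + 1) ≤
        (2 * l).choose (2 * p.2) * (2 * l + 2).choose (2 * p.2 + 1) := by
      exact_mod_cast choose_pow_four_mul_le l p.2
    push_cast
    simp only [add_zero]
    set x : ℝ := ((k.choose p.1 : ℕ) : ℝ)
    set y : ℝ := ((l.choose p.2 : ℕ) : ℝ)
    set X : ℝ := (((2 * k).choose (2 * p.1) : ℕ) : ℝ)
    set X' : ℝ := (((2 * k + 2).choose (2 * p.1 + 1) : ℕ) : ℝ)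
    set Y : ℝ := (((2 * l).choose (2 * p.2) : ℕ) : ℝ)
    set Y' : ℝ := (((2 * l + 2).choose (2 * p.2 + 1) : ℕ) : ℝ)
    have hX : 0 ≤ X := Nat.cast_nonneg _
    have hX' : 0 ≤ X' := Nat.cast_nonneg _
    have hY : 0 ≤ Y := Nat.cast_nonneg _
    have hY' : 0 ≤ Y' := Nat.cast_nonneg _
    refine le_of_sq_le_sq ?_ (by positivity)
    calc ((x * y) ^ 2 * √((k + 1) * (l + 1))) ^ 2
        = (x ^ 4 * (k + 1)) * (y ^ 4 * (l + 1)) := by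
          rw [mul_pow, sq_sqrt (by positivity)]; ring
      _ ≤ (X * X') * (Y * Y') := by gcongr
      _ ≤ ((X * Y' + X' * Y) / 2) ^ 2 := by nlinarith [sq_nonneg (X * Y' - X' * Y)]
  refine (Finset.sum_le_sum hterm).trans ?_
  rw [← Finset.sum_div, Finset.sum_add_distrib, ← Nat.cast_sum, ← Nat.cast_sum]
  have h1' : ((∑ p ∈ Finset.HasAntidiagonal.antidiagonal n,
    (2 * k).choose (2 * p.1 + 0) * (2 * l + 2).choose (2 * p.2 + 1) : ℕ) : ℝ) ≤ _ := Nat.cast_le.2 h1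
  have h2' : ((∑ p ∈ Finset.HasAntidiagonal.antidiagonal n,
    (2 * k + 2).choose (2 * p.1 + 1) * (2 * l).choose (2 * p.2 + 0) : ℕ) : ℝ) ≤ _ := Nat.cast_le.2 h2
  linarith

lemma sum_range_inv_sqrt_le (n : ℕ) : ∑ k ∈ Finset.range n, (√(k + 1 : ℝ))⁻¹ ≤ 2 * √n := by
  induction n with
  | zero => simp
  | succ n ih =>
    rw [Finset.sum_range_succ]
    push_cast
    set a := √(n : ℝ) with ha
    set b := √(n + 1 : ℝ) with hb
    have ha2 : a ^ 2 = n := sq_sqrt (by positivity)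
    have hb2 : b ^ 2 = n + 1 := sq_sqrt (by positivity)
    have hb0 : 0 < b := by positivity
    have : b⁻¹ ≤ 2 * (b - a) := by
      rw [inv_le_iff_one_le_mul₀ hb0]
      nlinarith [sq_nonneg (b - a)]
    linarith

lemma sum_antidiagonal_inv_sqrt_le (m : ℕ) :
    ∑ q ∈ Finset.HasAntidiagonal.antidiagonal m, (√((q.1 + 1) * (q.2 + 1) : ℝ))⁻¹ ≤ 4 := by
  have hterm : ∀ q ∈ Finset.HasAntidiagonal.antidiagonal m, (√((q.1 + 1) * (q.2 + 1) : ℝ))⁻¹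
      ≤ ((√(q.1 + 1 : ℝ))⁻¹ + (√(q.2 + 1 : ℝ))⁻¹) / √(m + 1 : ℝ) := by
    intro q hq
    have hq' : (q.1 : ℝ) + q.2 = m := by exact_mod_cast Finset.HasAntidiagonal.mem_antidiagonal.1 hq
    rw [sqrt_mul (by positivity)]
    set x := √(q.1 + 1 : ℝ)
    set y := √(q.2 + 1 : ℝ)
    have hx : 0 < x := by positivity
    have hy : 0 < y := by positivity
    have hz : √(m + 1 : ℝ) ≤ x + y := by
      rw [sqrt_le_left (by positivity)]
      have hx2 : x ^ 2 = q.1 + 1 := sq_sqrt (by positivity)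
      have hy2 : y ^ 2 = q.2 + 1 := sq_sqrt (by positivity)
      nlinarith [mul_pos hx hy]
    rw [le_div_iff₀ (by positivity), inv_add_inv hx.ne' hy.ne', inv_mul_eq_div]
    gcongr
  refine (Finset.sum_le_sum hterm).trans ?_
  have hswap : ∑ q ∈ Finset.HasAntidiagonal.antidiagonal m, (√(q.2 + 1 : ℝ))⁻¹
      = ∑ q ∈ Finset.HasAntidiagonal.antidiagonal m, (√(q.1 + 1 : ℝ))⁻¹ := by
    rw [← Finset.Nat.sum_antidiagonal_swap]; rfl
  have hrange : ∑ q ∈ Finset.HasAntidiagonal.antidiagonal m, (√(q.1 + 1 : ℝ))⁻¹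
      = ∑ k ∈ Finset.range (m + 1), (√(k + 1 : ℝ))⁻¹ :=
    Finset.Nat.sum_antidiagonal_eq_sum_range_succ_mk (fun q : ℕ × ℕ => (√(q.1 + 1 : ℝ))⁻¹) m
  have hle := sum_range_inv_sqrt_le (m + 1)
  push_cast at hle
  rw [← Finset.sum_div, Finset.sum_add_distrib, hswap, hrange, div_le_iff₀ (by positivity)]
  linarith

/-- The number of common sites of pairs of up-right paths, in terms of binomial coefficients. -/
lemma sum_antidiagonal_choose_sq_le (m n : ℕ) :
    ∑ q ∈ Finset.HasAntidiagonal.antidiagonal m, ∑ p ∈ Finset.HasAntidiagonal.antidiagonal n,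
      ((q.1.choose p.1 * q.2.choose p.2 : ℕ) : ℝ) ^ 2 ≤ 4 * (2 * m + 2).choose (2 * n + 1) := by
  have h : ∀ q ∈ Finset.HasAntidiagonal.antidiagonal m, ∑ p ∈ Finset.HasAntidiagonal.antidiagonal n,
      ((q.1.choose p.1 * q.2.choose p.2 : ℕ) : ℝ) ^ 2
      ≤ (2 * m + 2).choose (2 * n + 1) * (√((q.1 + 1) * (q.2 + 1) : ℝ))⁻¹ := by
    intro q hq
    have := sum_choose_sq_mul_choose_sq_mul_sqrt_le q.1 q.2 n
    rwa [Finset.HasAntidiagonal.mem_antidiagonal.1 hq, div_eq_mul_inv] at this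
  refine (Finset.sum_le_sum h).trans ?_
  rw [← Finset.mul_sum, mul_comm]
  gcongr
  exact sum_antidiagonal_inv_sqrt_le m

lemma two_mul_add_two_choose_sq_mul_le (i j : ℕ) :
    (2 * (i + j) + 2).choose (2 * i + 1) ^ 2 * ((2 * i + 1) * (2 * j + 1))
      ≤ 32 * (i + j + 1) ^ 3 * (i + j).choose i ^ 4 := by
  have hA := add_choose_sq_mul_centralBinom i j
  rw [← mul_add] at hA
  have hX := two_mul_add_two_choose_mul i j
  have hi := sixteen_pow_le_mul_centralBinom_sq i
  have hj := sixteen_pow_le_mul_centralBinom_sq j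
  have hk := centralBinom_sq_mul_le (i + j)
  set A := (i + j).choose i
  set X := (2 * (i + j)).choose (2 * i)
  set Y := (2 * (i + j) + 2).choose (2 * i + 1)
  set c := (i + j).centralBinom
  set a := i.centralBinom
  set b := j.centralBinom
  have ha : 0 < a := Nat.centralBinom_pos _
  have hb : 0 < b := Nat.centralBinom_pos _
  set p := (2 * i + 1) * (2 * j + 1) with hp
  have hp0 : 0 < p := by positivity
  have hp4 : (4 * i + 1) * (4 * j + 1) ≤ 4 * p := by rw [hp]; nlinarith
  have hcab : c ^ 2 * (2 * (i + j) + 1) ≤ 4 * p * (a ^ 2 * b ^ 2) := by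
    calc c ^ 2 * (2 * (i + j) + 1) ≤ 16 ^ i * 16 ^ j := by rw [← pow_add]; exact hk
      _ ≤ ((4 * i + 1) * a ^ 2) * ((4 * j + 1) * b ^ 2) := by gcongr
      _ = ((4 * i + 1) * (4 * j + 1)) * (a ^ 2 * b ^ 2) := by ring
      _ ≤ _ := by gcongr
  refine Nat.le_of_mul_le_mul_right (c := p * (a ^ 2 * b ^ 2)) ?_ (by positivity)
  calc Y ^ 2 * p * (p * (a ^ 2 * b ^ 2)) = (Y * p) ^ 2 * (a ^ 2 * b ^ 2) := by ring
    _ = (X * a * b) ^ 2 * ((2 * (i + j) + 1) * (2 * (i + j) + 2)) ^ 2 := by rw [hX]; ring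
    _ = A ^ 4 * (c ^ 2 * (2 * (i + j) + 1)) * ((2 * (i + j) + 1) * (2 * (i + j) + 2) ^ 2) := by
        rw [← hA]; ring
    _ ≤ A ^ 4 * (4 * p * (a ^ 2 * b ^ 2)) * ((2 * (i + j) + 2) * (2 * (i + j) + 2) ^ 2) := by
        gcongr; omega
    _ = _ := by ring

/-- The number of elements of `T` below `k`. -/
def countBelow (T : Finset ℕ) (k : ℕ) : ℕ := (T.filter (· < k)).card

lemma countBelow_zero (T : Finset ℕ) : countBelow T 0 = 0 := by simp [countBelow]

lemma countBelow_succ (T : Finset ℕ) (k : ℕ) :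
    countBelow T (k + 1) = countBelow T k + if k ∈ T then 1 else 0 := by
  have : T.filter (· < k + 1) = T.filter (· < k) ∪ T.filter (· = k) := by
    ext x; simp only [Finset.mem_filter, Finset.mem_union]; grind
  rw [countBelow, this, Finset.card_union_of_disjoint, Finset.filter_eq', countBelow]
  · split_ifs <;> simp
  · rw [Finset.disjoint_filter]; intros; omega

lemma countBelow_le_add (T : Finset ℕ) (k l : ℕ) :
    countBelow T k ≤ countBelow T (k + l) ∧ countBelow T (k + l) ≤ countBelow T k + l := by
  induction l with
  | zero => simp
  | succ l ih =>
    rw [← add_assoc, countBelow_succ]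
    split_ifs <;> omega

lemma countBelow_le (T : Finset ℕ) (k : ℕ) : countBelow T k ≤ k := by
  simpa [countBelow_zero] using (countBelow_le_add T 0 k).2

lemma countBelow_eq_of_mem_powersetCard {T : Finset ℕ} {m n : ℕ}
    (hT : T ∈ (Finset.range m).powersetCard n) : countBelow T m = n := by
  obtain ⟨h1, h2⟩ := Finset.mem_powersetCard.1 hT
  rw [countBelow, Finset.filter_true_of_mem, h2]
  exact fun x hx => Finset.mem_range.1 (h1 hx)

/-- The sites of the path of `m` steps whose `k`-th step is in the first direction exactly
when `k ∈ T`. -/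
def pathSites (m : ℕ) (T : Finset ℕ) : Finset (ℕ × ℕ) :=
  (Finset.range (m + 1)).image fun k => (1 + countBelow T k, 1 + (k - countBelow T k))

lemma mem_pathSites {m : ℕ} {T : Finset ℕ} {a : ℕ × ℕ} :
    a ∈ pathSites m T ↔
      1 ≤ a.1 ∧ 1 ≤ a.2 ∧ a.1 + a.2 - 2 ≤ m ∧ countBelow T (a.1 + a.2 - 2) = a.1 - 1 := by
  obtain ⟨i, j⟩ := a
  simp only [pathSites, Finset.mem_image, Finset.mem_range, Prod.mk.injEq]
  constructor
  · rintro ⟨k, hk, rfl, rfl⟩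
    have := countBelow_le T k
    have h : 1 + countBelow T k + (1 + (k - countBelow T k)) - 2 = k := by omega
    rw [h]
    omega
  · rintro ⟨h1, h2, h3, h4⟩
    exact ⟨i + j - 2, by omega, by omega, by omega⟩

lemma card_pathSites (m : ℕ) (T : Finset ℕ) : (pathSites m T).card = m + 1 := by
  rw [pathSites, Finset.card_image_of_injective, Finset.card_range]
  intro k l h
  simp only [Prod.mk.injEq] at h
  have := countBelow_le T k
  have := countBelow_le T l
  omega

lemma pathSites_injOn (m : ℕ) :
    Set.InjOn (pathSites m) {T : Finset ℕ | T ⊆ Finset.range m} := by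
  intro T hT T' hT' h
  have hc : ∀ k ≤ m, countBelow T k = countBelow T' k := by
    intro k hk
    have hle := countBelow_le T k
    have hmem : (1 + countBelow T k, 1 + (k - countBelow T k)) ∈ pathSites m T' := by
      rw [← h, pathSites]
      exact Finset.mem_image.2 ⟨k, Finset.mem_range.2 (by omega), rfl⟩
    obtain ⟨-, -, -, h4⟩ := mem_pathSites.1 hmem
    simp only at h4
    rw [show 1 + countBelow T k + (1 + (k - countBelow T k)) - 2 = k by omega] at h4
    omega
  have hsucc : ∀ k < m, (k ∈ T ↔ k ∈ T') := by
    intro k hk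
    have h1 := hc (k + 1) hk
    rw [countBelow_succ, countBelow_succ, hc k hk.le] at h1
    split_ifs at h1 <;> simp_all
  ext k
  refine ⟨fun hk => (hsucc k (Finset.mem_range.1 (hT hk))).1 hk,
    fun hk => (hsucc k (Finset.mem_range.1 (hT' hk))).2 hk⟩

lemma mem_upRightPaths {N M : ℕ} {s : Finset (ℕ × ℕ)} :
    s ∈ upRightPaths N M ↔ s ⊆ box N M ∧ IsUpRightPath N M s := by
  classical
  rw [upRightPaths, Finset.mem_filter, Finset.mem_powerset]

lemma pathSites_mem_upRightPaths {n b : ℕ} {T : Finset ℕ}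
    (hT : T ∈ (Finset.range (n + b)).powersetCard n) :
    pathSites (n + b) T ∈ upRightPaths (n + 1) (b + 1) := by
  have hm := countBelow_eq_of_mem_powersetCard hT
  rw [mem_upRightPaths]
  constructor
  · intro a ha
    obtain ⟨h1, h2, h3, h4⟩ := mem_pathSites.1 ha
    obtain ⟨l, hl⟩ := Nat.exists_eq_add_of_le h3
    have := countBelow_le_add T (a.1 + a.2 - 2) l
    rw [← hl, hm, h4] at this
    simp only [box, Finset.mem_product, Finset.mem_Icc]
    omega
  · refine ⟨fun k => (1 + countBelow T k, 1 + (k - countBelow T k)), by simp [countBelow_zero],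
      ?_, ?_, ?_⟩
    · simp only [show n + 1 + (b + 1) - 2 = n + b by omega, hm]
      ext <;> simp only <;> omega
    · intro k _
      have := countBelow_le T k
      simp only [countBelow_succ, Prod.mk.injEq]
      split_ifs <;> omega
    · rw [show n + 1 + (b + 1) - 1 = n + b + 1 by omega, pathSites]

lemma exists_pathSites_eq {n b : ℕ} {s : Finset (ℕ × ℕ)}
    (hs : s ∈ upRightPaths (n + 1) (b + 1)) :
    ∃ T ∈ (Finset.range (n + b)).powersetCard n, pathSites (n + b) T = s := by
  rw [mem_upRightPaths] at hs
  obtain ⟨-, c, h0, hend, hstep, rfl⟩ := hs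
  rw [show n + 1 + (b + 1) - 2 = n + b by omega] at hend hstep
  set T := (Finset.range (n + b)).filter fun k => (c (k + 1)).1 = (c k).1 + 1 with hTdef
  have hc : ∀ k ≤ n + b, c k = (1 + countBelow T k, 1 + (k - countBelow T k)) := by
    intro k
    induction k with
    | zero => intro _; simp [countBelow_zero, h0]
    | succ k ih =>
      intro hk
      have hk' := ih (by omega)
      have hle := countBelow_le T k
      have hmem : k ∈ T ↔ (c (k + 1)).1 = (c k).1 + 1 := by
        simp only [hTdef, Finset.mem_filter, Finset.mem_range]
        exact and_iff_right (by omega)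
      rw [countBelow_succ]
      rcases hstep k (by omega) with h | h
      · rw [if_pos (hmem.2 (by rw [h])), h, hk']
        ext <;> simp only <;> omega
      · rw [if_neg (fun hkT => by have := hmem.1 hkT; rw [h] at this; simp at this), h, hk']
        ext <;> simp only <;> omega
  refine ⟨T, Finset.mem_powersetCard.2 ⟨Finset.filter_subset _ _, ?_⟩, ?_⟩
  · have h1 := hc (n + b) le_rfl
    rw [hend] at h1
    have h2 : countBelow T (n + b) = T.card := by
      rw [countBelow, Finset.filter_true_of_mem]
      exact fun x hx => Finset.mem_range.1 (Finset.filter_subset _ _ hx)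
    rw [h2] at h1
    simp only [Prod.mk.injEq] at h1
    omega
  · rw [pathSites, show n + 1 + (b + 1) - 1 = n + b + 1 by omega]
    refine Finset.image_congr fun k hk => ?_
    exact (hc k (Nat.lt_succ_iff.1 (Finset.mem_range.1 hk))).symm

lemma card_upRightPaths (n b : ℕ) : (upRightPaths (n + 1) (b + 1)).card = (n + b).choose n := by
  have : upRightPaths (n + 1) (b + 1)
      = ((Finset.range (n + b)).powersetCard n).image (pathSites (n + b)) := by
    ext s
    rw [Finset.mem_image]
    exact ⟨exists_pathSites_eq, fun ⟨T, hT, h⟩ => h ▸ pathSites_mem_upRightPaths hT⟩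
  rw [this, Finset.card_image_of_injOn, Finset.card_powersetCard, Finset.card_range]
  exact (pathSites_injOn _).mono fun T hT => (Finset.mem_powersetCard.1 hT).1

lemma card_of_mem_upRightPaths {n b : ℕ} {s : Finset (ℕ × ℕ)}
    (hs : s ∈ upRightPaths (n + 1) (b + 1)) : s.card = n + b + 1 := by
  obtain ⟨T, -, rfl⟩ := exists_pathSites_eq hs
  exact card_pathSites _ _

lemma subset_box_of_mem_upRightPaths {N M : ℕ} {s : Finset (ℕ × ℕ)}
    (hs : s ∈ upRightPaths N M) : s ⊆ box N M :=
  (mem_upRightPaths.1 hs).1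

lemma card_powersetCard_filter_countBelow_le (m n k i : ℕ) :
    (((Finset.range m).powersetCard n).filter fun T => countBelow T k = i).card
      ≤ k.choose i * (m - k).choose (n - i) := by
  have hcard : ((Finset.range k).powersetCard i ×ˢ (Finset.Ico k m).powersetCard (n - i)).card
      = k.choose i * (m - k).choose (n - i) := by simp
  rw [← hcard]
  refine Finset.card_le_card_of_injOn
    (fun T => (T.filter (· < k), T.filter fun x => ¬ x < k)) ?_ ?_
  · intro T hT
    obtain ⟨hT1, hT2⟩ := Finset.mem_filter.1 hT
    obtain ⟨h1, h2⟩ := Finset.mem_powersetCard.1 hT1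
    have hadd := Finset.card_filter_add_card_filter_not (s := T) (· < k)
    rw [countBelow] at hT2
    simp only [Finset.coe_product, Set.mem_prod, Finset.mem_coe, Finset.mem_powersetCard]
    refine ⟨⟨fun x hx => ?_, hT2⟩, fun x hx => ?_, by omega⟩
    · exact Finset.mem_range.2 (Finset.mem_filter.1 hx).2
    · obtain ⟨hx1, hx2⟩ := Finset.mem_filter.1 hx
      exact Finset.mem_Ico.2 ⟨not_lt.1 hx2, Finset.mem_range.1 (h1 hx1)⟩
  · intro T _ T' _ h
    simp only [Prod.mk.injEq] at h
    rw [← Finset.filter_union_filter_not_eq (· < k) T, h.1, h.2,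
      Finset.filter_union_filter_not_eq]

lemma card_upRightPaths_filter_mem_le (n b : ℕ) (a : ℕ × ℕ) :
    ((upRightPaths (n + 1) (b + 1)).filter fun s => a ∈ s).card
      ≤ (a.1 + a.2 - 2).choose (a.1 - 1) * (n + b - (a.1 + a.2 - 2)).choose (n - (a.1 - 1)) := by
  refine le_trans ?_ (card_powersetCard_filter_countBelow_le (n + b) n (a.1 + a.2 - 2) (a.1 - 1))
  refine Finset.card_le_card_of_surjOn (pathSites (n + b)) ?_
  intro s hs
  obtain ⟨hs1, hs2⟩ := Finset.mem_filter.1 hs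
  obtain ⟨T, hT, rfl⟩ := exists_pathSites_eq hs1
  exact ⟨T, Finset.mem_filter.2 ⟨hT, (mem_pathSites.1 hs2).2.2.2⟩, rfl⟩

lemma sum_box_card_filter_mem_sq_le (n b : ℕ) :
    ∑ a ∈ box (n + 1) (b + 1),
        ((((upRightPaths (n + 1) (b + 1)).filter fun s => a ∈ s).card : ℕ) : ℝ) ^ 2
      ≤ 4 * (2 * (n + b) + 2).choose (2 * n + 1) := by
  refine le_trans ?_ (sum_antidiagonal_choose_sq_le (n + b) n)
  rw [← Finset.sum_product']
  set g : ℕ × ℕ → (ℕ × ℕ) × (ℕ × ℕ) := fun a =>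
    ((a.1 + a.2 - 2, n + b - (a.1 + a.2 - 2)), (a.1 - 1, n - (a.1 - 1))) with hg
  set F : (ℕ × ℕ) × (ℕ × ℕ) → ℝ := fun x =>
    ((x.1.1.choose x.2.1 * x.1.2.choose x.2.2 : ℕ) : ℝ) ^ 2 with hF
  have hinj : Set.InjOn g (box (n + 1) (b + 1)) := by
    rintro ⟨i, j⟩ h ⟨i', j'⟩ h' heq
    simp only [box, Finset.mem_coe, Finset.mem_product, Finset.mem_Icc] at h h'
    simp only [hg, Prod.mk.injEq] at heq ⊢
    omega
  calc _ ≤ ∑ a ∈ box (n + 1) (b + 1), F (g a) := by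
        refine Finset.sum_le_sum fun a ha => ?_
        simp only [hF, hg]
        gcongr
        exact card_upRightPaths_filter_mem_le n b a
    _ = ∑ x ∈ (box (n + 1) (b + 1)).image g, F x := (Finset.sum_image hinj).symm
    _ ≤ _ := by
        refine Finset.sum_le_sum_of_subset_of_nonneg ?_ fun _ _ _ => sq_nonneg _
        intro x hx
        obtain ⟨a, ha, rfl⟩ := Finset.mem_image.1 hx
        simp only [box, Finset.mem_product, Finset.mem_Icc] at ha
        simp only [hg, Finset.mem_product, Finset.HasAntidiagonal.mem_antidiagonal]
        omega

/-- The mean overlap of two independent uniform up-right paths, relative to their length. -/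
lemma sum_box_card_filter_mem_div_sq_le (n b : ℕ) :
    (∑ a ∈ box (n + 1) (b + 1),
        ((((upRightPaths (n + 1) (b + 1)).filter fun s => a ∈ s).card : ℕ) : ℝ) ^ 2)
        / ((upRightPaths (n + 1) (b + 1)).card : ℝ) ^ 2 / (n + b + 1)
      ≤ √(512 * ((n + 1 : ℝ)⁻¹ + (b + 1 : ℝ)⁻¹)) := by
  rw [card_upRightPaths]
  have h1 := sum_box_card_filter_mem_sq_le n b
  have h2 : (((2 * (n + b) + 2).choose (2 * n + 1) : ℕ) : ℝ) ^ 2 * ((2 * n + 1) * (2 * b + 1))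
      ≤ 32 * (n + b + 1) ^ 3 * (((n + b).choose n : ℕ) : ℝ) ^ 4 := by
    exact_mod_cast two_mul_add_two_choose_sq_mul_le n b
  have h0 : 0 ≤ ∑ a ∈ box (n + 1) (b + 1),
    ((((upRightPaths (n + 1) (b + 1)).filter fun s => a ∈ s).card : ℕ) : ℝ) ^ 2 :=
    Finset.sum_nonneg fun _ _ => sq_nonneg _
  have hA : (0 : ℝ) < ((n + b).choose n : ℕ) := by
    exact_mod_cast Nat.choose_pos (Nat.le_add_right n b)
  have hY : (0 : ℝ) ≤ ((2 * (n + b) + 2).choose (2 * n + 1) : ℕ) := Nat.cast_nonneg _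
  generalize (((n + b).choose n : ℕ) : ℝ) = A at *
  generalize (((2 * (n + b) + 2).choose (2 * n + 1) : ℕ) : ℝ) = Y at *
  generalize (∑ a ∈ box (n + 1) (b + 1),
    ((((upRightPaths (n + 1) (b + 1)).filter fun s => a ∈ s).card : ℕ) : ℝ) ^ 2) = s at *
  refine le_sqrt_of_sq_le ?_
  have hn : (0 : ℝ) ≤ n := Nat.cast_nonneg _
  have hb : (0 : ℝ) ≤ b := Nat.cast_nonneg _
  calc _ ≤ (4 * Y / A ^ 2 / (n + b + 1)) ^ 2 := by
        refine pow_le_pow_left₀ (by positivity) ?_ 2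
        gcongr
    _ = 16 * (Y ^ 2 * ((2 * n + 1) * (2 * b + 1)))
          / (A ^ 4 * (n + b + 1) ^ 2 * ((2 * n + 1) * (2 * b + 1))) := by
        field_simp; ring
    _ ≤ 16 * (32 * (n + b + 1) ^ 3 * A ^ 4)
          / (A ^ 4 * (n + b + 1) ^ 2 * ((2 * n + 1) * (2 * b + 1))) := by gcongr
    _ = 512 * ((n + b + 1) / ((2 * n + 1) * (2 * b + 1))) := by field_simp; ring
    _ ≤ 512 * ((n + b + 2) / ((n + 1) * (b + 1))) := by gcongr <;> linarith
    _ = _ := by field_simp; ring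

/-- The unit vector proportional to the indicator of the sites of a path `s`. -/
noncomputable def pathVector (N M : ℕ) (s : Finset (ℕ × ℕ)) : EuclideanSpace ℝ ↥(box N M) :=
  WithLp.toLp 2 fun a => if (a : ℕ × ℕ) ∈ s then (√((M + N - 1 : ℕ) : ℝ))⁻¹ else 0

lemma pathAvgCentered_zero_eq_projAvg (N M : ℕ) (w : EuclideanSpace ℝ ↥(box N M)) (f : ℝ → ℝ) :
    pathAvgCentered N M (fun a => w a) 0 f
      = projAvg (upRightPaths N M) (pathVector N M) f w := by
  simp only [pathAvgCentered, projAvg, PiLp.inner_apply, pathVector, Finset.mul_sum,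
    Pi.zero_apply, sub_zero, mul_ite, mul_zero]
  refine Finset.sum_congr rfl fun s _ => ?_
  congr 2
  refine Finset.sum_congr rfl fun a _ => ?_
  split_ifs <;> simp

lemma card_box (N M : ℕ) : Fintype.card ↥(box N M) = N * M := by
  rw [Fintype.card_coe, box, Finset.card_product, Nat.card_Icc, Nat.card_Icc, Nat.add_sub_cancel,
    Nat.add_sub_cancel]

lemma norm_pathVector {n b : ℕ} {s : Finset (ℕ × ℕ)}
    (hs : s ∈ upRightPaths (n + 1) (b + 1)) : ‖pathVector (n + 1) (b + 1) s‖ = 1 := by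
  rw [EuclideanSpace.norm_eq, sqrt_eq_one]
  simp only [pathVector, norm_eq_abs, sq_abs]
  rw [Finset.sum_coe_sort (box (n + 1) (b + 1)) (fun a : ℕ × ℕ =>
    (if a ∈ s then (√((b + 1 + (n + 1) - 1 : ℕ) : ℝ))⁻¹ else 0) ^ 2)]
  simp only [ite_pow, inv_pow, ne_eq, OfNat.ofNat_ne_zero, not_false_eq_true, zero_pow]
  rw [← Finset.sum_filter, Finset.sum_const, Finset.filter_mem_eq_inter,
    Finset.inter_eq_right.2 (subset_box_of_mem_upRightPaths hs), card_of_mem_upRightPaths hs,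
    sq_sqrt (Nat.cast_nonneg _), nsmul_eq_mul, show b + 1 + (n + 1) - 1 = n + b + 1 by omega]
  exact mul_inv_cancel₀ (by positivity)

lemma sum_mul_pathVector_sq_le (n b : ℕ) (K : ℝ) :
    ∑ a, (K * (((upRightPaths (n + 1) (b + 1)).card : ℝ)⁻¹ *
        ∑ s ∈ upRightPaths (n + 1) (b + 1), |pathVector (n + 1) (b + 1) s a|)) ^ 2
      ≤ K ^ 2 * √(512 * ((n + 1 : ℝ)⁻¹ + (b + 1 : ℝ)⁻¹)) := by
  have hcount : ∀ a : ↥(box (n + 1) (b + 1)),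
      ∑ s ∈ upRightPaths (n + 1) (b + 1), |pathVector (n + 1) (b + 1) s a|
        = ((((upRightPaths (n + 1) (b + 1)).filter fun s => (a : ℕ × ℕ) ∈ s).card : ℕ) : ℝ)
          * (√((n + b + 1 : ℕ) : ℝ))⁻¹ := by
    intro a
    simp only [pathVector, show b + 1 + (n + 1) - 1 = n + b + 1 by omega]
    have : ∀ s : Finset (ℕ × ℕ), |if (a : ℕ × ℕ) ∈ s then (√((n + b + 1 : ℕ) : ℝ))⁻¹ else 0|
        = if (a : ℕ × ℕ) ∈ s then (√((n + b + 1 : ℕ) : ℝ))⁻¹ else 0 :=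
      fun s => abs_of_nonneg (by positivity)
    simp only [this]
    rw [← Finset.sum_filter, Finset.sum_const, nsmul_eq_mul]
  simp only [hcount]
  rw [Finset.sum_coe_sort (box (n + 1) (b + 1)) (fun a : ℕ × ℕ =>
    (K * (((upRightPaths (n + 1) (b + 1)).card : ℝ)⁻¹ *
      (((((upRightPaths (n + 1) (b + 1)).filter fun s => a ∈ s).card : ℕ) : ℝ)
          * (√((n + b + 1 : ℕ) : ℝ))⁻¹))) ^ 2)]
  refine le_trans (le_of_eq ?_)
    (mul_le_mul_of_nonneg_left (sum_box_card_filter_mem_div_sq_le n b) (sq_nonneg K))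
  rw [Finset.sum_div, Finset.sum_div, Finset.mul_sum]
  refine Finset.sum_congr rfl fun a _ => ?_
  rw [mul_pow, mul_pow, mul_pow, inv_pow, inv_pow, sq_sqrt (Nat.cast_nonneg _)]
  push_cast
  ring

/-- Quantitative concentration of the quenched averages over paths around the Gaussian mean. -/
lemma measureReal_pathAvgCentered_le {N M : ℕ} (hN : 0 < N) (hM : 0 < M)
    {ν : Measure (EuclideanSpace ℝ ↥(box N M))} [IsProbabilityMeasure ν]
    (hν : ν = sphereUniform ↥(box N M) (√((N * M : ℕ) : ℝ)))
    {f : ℝ → ℝ} {B K ε : ℝ} (hfm : Measurable f) (hB : ∀ x, |f x| ≤ B)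
    (hK : 0 < K) (hf : ∀ x y, |f x - f y| ≤ K * |x - y|) (hε : 0 < ε) :
    ν.real {w | 2 * ε ≤ |pathAvgCentered N M (fun a => w a) 0 f
        - ∫ x, f x ∂(gaussianReal 0 1)|}
      ≤ 2 * exp (-(ε ^ 2 / (4 * (K ^ 2 * √(512 * ((N : ℝ)⁻¹ + (M : ℝ)⁻¹))))))
        + K ^ 2 * (Var[fun x => x ^ 2; gaussianReal 0 1] / (N * M)) / ε ^ 2 := by
  obtain ⟨n, rfl⟩ := Nat.exists_eq_succ_of_ne_zero hN.ne'
  obtain ⟨b, rfl⟩ := Nat.exists_eq_succ_of_ne_zero hM.ne'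
  simp only [Nat.succ_eq_add_one] at *
  have : Nonempty ↥(box (n + 1) (b + 1)) := ⟨(1, 1), by simp [box]⟩
  have hne : (upRightPaths (n + 1) (b + 1)).Nonempty := by
    rw [← Finset.card_pos, card_upRightPaths]
    exact Nat.choose_pos (Nat.le_add_right n b)
  have h := measureReal_projAvg_le (ν := ν) (by rw [hν]; exact map_sphereUniform _ _)
    (by rw [hν, card_box]; exact ae_norm_eq_sphereUniform _ _) hne
    (fun s hs => norm_pathVector hs) hfm hB hf
    (by positivity : 0 < K ^ 2 * √(512 * ((n + 1 : ℝ)⁻¹ + (b + 1 : ℝ)⁻¹)))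
    (sum_mul_pathVector_sq_le n b K) hε
  simp only [pathAvgCentered_zero_eq_projAvg]
  rw [card_box] at h
  push_cast at h ⊢
  exact h

lemma integral_apply_sphereUniform (ι : Type) [Fintype ι] (r : ℝ)
    [IsProbabilityMeasure (sphereUniform ι r)] (a : ι) :
    ∫ w, w a ∂(sphereUniform ι r) = 0 := by
  classical
  have := integral_inner_eq_zero (map_sphereUniform ι r) (EuclideanSpace.single a (1 : ℝ))
  simpa [EuclideanSpace.inner_single_right] using this

lemma exp_neg_le_div_pow_four {x : ℝ} (hx : 0 < x) : exp (-x) ≤ 24 / x ^ 4 := by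
  have h := pow_div_factorial_le_exp x hx.le 4
  rw [exp_neg, inv_le_comm₀ (exp_pos x) (by positivity), inv_div]
  simpa [Nat.factorial] using h

lemma eventually_mul_le_floor {ξ : ℝ} (hξ : 0 < ξ) :
    ∀ᶠ N : ℕ in atTop, ξ / 2 * N ≤ (⌊ξ * (N : ℝ)⌋₊ : ℝ) := by
  filter_upwards [tendsto_natCast_atTop_atTop.eventually_ge_atTop (2 / ξ)] with N hN
  have h1 := Nat.lt_floor_add_one (ξ * (N : ℝ))
  have h2 : 2 ≤ ξ * N := by
    rw [div_le_iff₀ hξ] at hN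
    linarith
  linarith

lemma ae_tendsto_of_measureReal_le {Ω : Type*} [MeasurableSpace Ω] {P : Measure Ω}
    [IsFiniteMeasure P] {X : ℕ → Ω → ℝ} {m : ℝ}
    (h : ∀ ε > 0, ∃ C : ℝ, ∀ᶠ N : ℕ in atTop, P.real {ω | ε ≤ |X N ω - m|} ≤ C / (N : ℝ) ^ 2) :
    ∀ᵐ ω ∂P, Tendsto (fun N => X N ω) atTop (nhds m) := by
  have hk : ∀ k : ℕ, ∀ᵐ ω ∂P, ∀ᶠ N in atTop, ω ∉ {ω | 1 / ((k : ℝ) + 1) ≤ |X N ω - m|} := by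
    intro k
    refine ae_eventually_notMem ?_
    obtain ⟨C, hC⟩ := h (1 / ((k : ℝ) + 1)) (by positivity)
    have hsum : Summable fun N : ℕ => P.real {ω | 1 / ((k : ℝ) + 1) ≤ |X N ω - m|} := by
      refine Summable.of_norm_bounded_eventually_nat (g := fun N : ℕ => C / (N : ℝ) ^ 2) ?_ ?_
      · simp_rw [div_eq_mul_one_div C]
        exact (Real.summable_one_div_nat_pow.2 one_lt_two).mul_left C
      · filter_upwards [hC] with N hN
        rwa [norm_of_nonneg measureReal_nonneg]
    have := hsum.tsum_ofReal_ne_top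
    simpa only [measureReal_def, ENNReal.ofReal_toReal (measure_ne_top P _)] using this
  filter_upwards [ae_all_iff.2 hk] with ω hω
  rw [Metric.tendsto_atTop']
  intro ε hε
  obtain ⟨k, hk⟩ := exists_nat_one_div_lt hε
  obtain ⟨N, hN⟩ := eventually_atTop.1 (hω k)
  refine ⟨N, fun n hn => ?_⟩
  have := hN n hn.le
  simp only [not_le] at this
  rw [Real.dist_eq]
  exact this.trans hk

lemma ae_tendsto_pathAvgCentered {ξ : ℝ} (hξ : 0 < ξ) {M : ℕ → ℕ}
    (hM : ∀ N, M N = ⌊ξ * (N : ℝ)⌋₊) {Ω : Type*} [MeasurableSpace Ω] {P : Measure Ω}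
    [IsProbabilityMeasure P] {W : ∀ N : ℕ, Ω → EuclideanSpace ℝ ↥(box N (M N))}
    (hmeas : ∀ N, Measurable (W N))
    (hlaw : ∀ N, Measure.map (W N) P =
      sphereUniform ↥(box N (M N)) (√((N * M N : ℕ) : ℝ)))
    {f : ℝ → ℝ} {B K : ℝ} (hfm : Measurable f) (hB : ∀ x, |f x| ≤ B)
    (hK : 0 < K) (hf : ∀ x y, |f x - f y| ≤ K * |x - y|) :
    ∀ᵐ ω ∂P, Tendsto (fun N => pathAvgCentered N (M N) (fun a => W N ω a) 0 f) atTop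
      (nhds (∫ x, f x ∂(gaussianReal 0 1))) := by
  refine ae_tendsto_of_measureReal_le fun δ hδ => ?_
  obtain ⟨ε, hε, rfl⟩ : ∃ ε > 0, δ = 2 * ε := ⟨δ / 2, by positivity, by ring⟩
  set v := Var[fun x => x ^ 2; gaussianReal 0 1] with hv
  have hv0 : 0 ≤ v := variance_nonneg _ _
  refine ⟨2 * (24 * (4 * K ^ 2 / ε ^ 2) ^ 4 * (512 * (1 + 2 / ξ)) ^ 2)
    + K ^ 2 * v * (2 / ξ) / ε ^ 2, ?_⟩
  filter_upwards [eventually_mul_le_floor hξ, eventually_gt_atTop 0] with N hMN hN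
  rw [← hM N] at hMN
  have hNr : (0 : ℝ) < N := Nat.cast_pos.2 hN
  have hMr : (0 : ℝ) < M N := lt_of_lt_of_le (by positivity) hMN
  have hMpos : 0 < M N := Nat.cast_pos.1 hMr
  have := Measure.isProbabilityMeasure_map (μ := P) (hmeas N).aemeasurable
  have hmain := measureReal_pathAvgCentered_le hN hMpos (hlaw N) hfm hB hK hf hε
  rw [map_measureReal_apply (hmeas N)] at hmain
  swap
  · simp only [pathAvgCentered_zero_eq_projAvg]
    exact measurableSet_le measurable_const
      (((measurable_projAvg hfm).sub_const _).abs)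
  refine hmain.trans ?_
  have hMinv : (M N : ℝ)⁻¹ ≤ 2 / ξ / N := by
    rw [inv_le_comm₀ hMr (by positivity)]
    refine le_trans (le_of_eq ?_) hMN
    field_simp
  rw [add_div]
  gcongr ?_ + ?_
  · rw [mul_div_assoc]
    gcongr 2 * ?_
    set q : ℝ := 512 * ((N : ℝ)⁻¹ + (M N : ℝ)⁻¹) with hq
    have hq0 : 0 < q := by positivity
    have hqle : q ≤ 512 * (1 + 2 / ξ) / N := by
      calc q ≤ 512 * ((N : ℝ)⁻¹ + 2 / ξ / N) := by rw [hq]; gcongr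
        _ = _ := by field_simp
    refine (exp_neg_le_div_pow_four (by positivity)).trans ?_
    calc 24 / (ε ^ 2 / (4 * (K ^ 2 * √q))) ^ 4
        = 24 * (4 * K ^ 2 / ε ^ 2) ^ 4 * (√q ^ 2) ^ 2 := by field_simp
      _ = 24 * (4 * K ^ 2 / ε ^ 2) ^ 4 * q ^ 2 := by rw [sq_sqrt hq0.le]
      _ ≤ 24 * (4 * K ^ 2 / ε ^ 2) ^ 4 * (512 * (1 + 2 / ξ) / N) ^ 2 := by gcongr
      _ = _ := by ring
  · calc K ^ 2 * (v / (N * M N)) / ε ^ 2 = K ^ 2 * v / ε ^ 2 / N * (M N : ℝ)⁻¹ := by field_simp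
      _ ≤ K ^ 2 * v / ε ^ 2 / N * (2 / ξ / N) := by gcongr
      _ = _ := by ring

/-- The piecewise linear bump of height `1` and width `2 / (k + 1)` centered at `j / (k + 1)`. -/
noncomputable def tent (k : ℕ) (j : ℤ) (x : ℝ) : ℝ := max 0 (1 - |(k + 1) * x - j|)

lemma tent_nonneg (k : ℕ) (j : ℤ) (x : ℝ) : 0 ≤ tent k j x := le_max_left _ _

lemma abs_tent_le_one (k : ℕ) (j : ℤ) (x : ℝ) : |tent k j x| ≤ 1 := by
  rw [abs_of_nonneg (tent_nonneg k j x)]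
  exact max_le zero_le_one (by linarith [abs_nonneg ((k + 1) * x - j)])

lemma continuous_tent (k : ℕ) (j : ℤ) : Continuous (tent k j) := by
  unfold tent
  fun_prop

lemma abs_tent_sub_le (k : ℕ) (j : ℤ) (x y : ℝ) :
    |tent k j x - tent k j y| ≤ (k + 1) * |x - y| := by
  calc |tent k j x - tent k j y|
      ≤ |(1 - |(k + 1) * x - j|) - (1 - |(k + 1) * y - j|)| := by
        unfold tent
        rw [max_comm, max_comm (0 : ℝ)]
        exact abs_max_sub_max_le_abs _ _ _
    _ = |(|(k + 1) * y - j|) - (|(k + 1) * x - j|)| := by congr 1; ring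
    _ ≤ |((k + 1) * y - j) - ((k + 1) * x - j)| := abs_abs_sub_abs_le_abs_sub _ _
    _ = |(k + 1) * (x - y)| := by rw [← abs_neg]; congr 1; ring
    _ = _ := by rw [abs_mul, abs_of_nonneg (by positivity : (0 : ℝ) ≤ k + 1)]

lemma tent_eq_zero {k : ℕ} {j : ℤ} {x : ℝ} (h : 1 ≤ |(k + 1) * x - j|) : tent k j x = 0 :=
  max_eq_left (by linarith)

lemma sum_floor_tent (k : ℕ) (x : ℝ) :
    ∑ j ∈ {⌊((k : ℝ) + 1) * x⌋, ⌊((k : ℝ) + 1) * x⌋ + 1}, tent k j x = 1 := by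
  have h1 := Int.floor_le (((k : ℝ) + 1) * x)
  have h2 := Int.lt_floor_add_one (((k : ℝ) + 1) * x)
  rw [Finset.sum_pair (by omega), tent, tent]
  push_cast
  rw [abs_of_nonneg (by linarith), abs_of_nonpos (by linarith), max_eq_right (by linarith),
    max_eq_right (by linarith)]
  ring

lemma tent_eq_zero_of_notMem {k : ℕ} {j : ℤ} {x : ℝ}
    (h : j ∉ ({⌊((k : ℝ) + 1) * x⌋, ⌊((k : ℝ) + 1) * x⌋ + 1} : Finset ℤ)) : tent k j x = 0 := by
  refine tent_eq_zero ?_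
  have h1 := Int.floor_le (((k : ℝ) + 1) * x)
  have h2 := Int.lt_floor_add_one (((k : ℝ) + 1) * x)
  simp only [Finset.mem_insert, Finset.mem_singleton, not_or] at h
  rcases lt_or_ge j ⌊((k : ℝ) + 1) * x⌋ with hlt | hge
  · have : (j : ℝ) + 1 ≤ ⌊((k : ℝ) + 1) * x⌋ := by exact_mod_cast hlt
    exact le_abs.2 (Or.inl (by linarith))
  · have : (⌊((k : ℝ) + 1) * x⌋ : ℝ) + 2 ≤ j := by
      have : ⌊((k : ℝ) + 1) * x⌋ + 2 ≤ j := by omega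
      exact_mod_cast this
    exact le_abs.2 (Or.inr (by linarith))

lemma sum_tent_le_one (k : ℕ) (s : Finset ℤ) (x : ℝ) : ∑ j ∈ s, tent k j x ≤ 1 := by
  set t : Finset ℤ := {⌊((k : ℝ) + 1) * x⌋, ⌊((k : ℝ) + 1) * x⌋ + 1}
  calc ∑ j ∈ s, tent k j x ≤ ∑ j ∈ s ∪ t, tent k j x :=
        Finset.sum_le_sum_of_subset_of_nonneg Finset.subset_union_left
          fun j _ _ => tent_nonneg k j x
    _ = ∑ j ∈ t, tent k j x :=
        (Finset.sum_subset Finset.subset_union_right fun j _ hj => tent_eq_zero_of_notMem hj).symm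
    _ = 1 := sum_floor_tent k x

lemma sum_tent_eq_one {k : ℕ} {s : Finset ℤ} {x : ℝ}
    (h : {⌊((k : ℝ) + 1) * x⌋, ⌊((k : ℝ) + 1) * x⌋ + 1} ⊆ s) : ∑ j ∈ s, tent k j x = 1 := by
  rw [← sum_floor_tent k x]
  exact (Finset.sum_subset h fun j _ hj => tent_eq_zero_of_notMem hj).symm

lemma integrable_tent (k : ℕ) (j : ℤ) (μ : Measure ℝ) [IsProbabilityMeasure μ] :
    Integrable (tent k j) μ :=
  Integrable.of_bound (continuous_tent k j).aestronglyMeasurable 1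
    (ae_of_all _ (abs_tent_le_one k j))

lemma tendsto_integral_sum_tent (k : ℕ) (γ : Measure ℝ) [IsProbabilityMeasure γ] :
    Tendsto (fun J : ℕ => ∫ x, ∑ j ∈ Finset.Icc (-(J : ℤ)) J, tent k j x ∂γ) atTop (nhds 1) := by
  have h1 : ∫ _, (1 : ℝ) ∂γ = 1 := by simp
  rw [← h1]
  refine tendsto_integral_of_dominated_convergence (fun _ => 1) (fun J => ?_)
    (integrable_const 1) (fun J => ae_of_all _ fun x => ?_) (ae_of_all _ fun x => ?_)
  · exact (continuous_finsetSum _ fun j _ => continuous_tent k j).aestronglyMeasurable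
  · rw [norm_of_nonneg (Finset.sum_nonneg fun j _ => tent_nonneg k j x)]
    exact sum_tent_le_one _ _ _
  · refine tendsto_const_nhds.congr' ?_
    filter_upwards [eventually_ge_atTop (⌊((k : ℝ) + 1) * x⌋.natAbs + 1)] with J hJ
    refine (sum_tent_eq_one fun j hj => ?_).symm
    simp only [Finset.mem_insert, Finset.mem_singleton] at hj
    rw [Finset.mem_Icc]
    omega

lemma abs_sub_sum_tent_le {f : ℝ → ℝ} {B : ℝ} (hB : ∀ x, |f x| ≤ B)
    (hf : ∀ x y, |f x - f y| ≤ |x - y|) (k : ℕ) (s : Finset ℤ) (x : ℝ) :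
    |f x - ∑ j ∈ s, f (j / (k + 1)) * tent k j x|
      ≤ 1 / ((k : ℝ) + 1) + B * (1 - ∑ j ∈ s, tent k j x) := by
  have hχ := sum_tent_le_one k s x
  have hterm : ∀ j ∈ s, |(f x - f (j / (k + 1))) * tent k j x| ≤ 1 / ((k : ℝ) + 1) * tent k j x := by
    intro j _
    rcases le_or_gt 1 |(k + 1) * x - j| with h | h
    · simp [tent_eq_zero h]
    · rw [abs_mul, abs_of_nonneg (tent_nonneg k j x)]
      refine mul_le_mul_of_nonneg_right ((hf _ _).trans ?_) (tent_nonneg k j x)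
      have : x - j / (k + 1) = ((k + 1) * x - j) / (k + 1) := by field_simp
      rw [this, abs_div, abs_of_nonneg (by positivity : (0 : ℝ) ≤ k + 1)]
      gcongr
  have hsplit : f x - ∑ j ∈ s, f (j / (k + 1)) * tent k j x
      = ∑ j ∈ s, (f x - f (j / (k + 1))) * tent k j x + f x * (1 - ∑ j ∈ s, tent k j x) := by
    simp only [sub_mul, Finset.sum_sub_distrib, ← Finset.mul_sum]
    ring
  rw [hsplit]
  refine (abs_add_le _ _).trans (add_le_add ?_ ?_)
  · refine (Finset.abs_sum_le_sum_abs _ _).trans ((Finset.sum_le_sum hterm).trans ?_)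
    rw [← Finset.mul_sum]
    exact mul_le_of_le_one_right (by positivity) hχ
  · rw [abs_mul, abs_of_nonneg (sub_nonneg.2 hχ)]
    exact mul_le_mul_of_nonneg_right (hB x) (sub_nonneg.2 hχ)

lemma abs_integral_sub_sum_tent_le {f : ℝ → ℝ} {B : ℝ} (hB : ∀ x, |f x| ≤ B)
    (hfc : Continuous f) (hf : ∀ x y, |f x - f y| ≤ |x - y|) (k : ℕ) (s : Finset ℤ)
    (μ : Measure ℝ) [IsProbabilityMeasure μ] :
    |∫ x, f x ∂μ - ∑ j ∈ s, f (j / (k + 1)) * ∫ x, tent k j x ∂μ|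
      ≤ 1 / ((k : ℝ) + 1) + B * (1 - ∑ j ∈ s, ∫ x, tent k j x ∂μ) := by
  have hfi : Integrable f μ := Integrable.of_bound hfc.aestronglyMeasurable B (ae_of_all _ hB)
  have hχi : Integrable (fun x => ∑ j ∈ s, tent k j x) μ :=
    integrable_finsetSum _ fun j _ => integrable_tent k j μ
  have hgi : Integrable (fun x => ∑ j ∈ s, f (j / (k + 1)) * tent k j x) μ :=
    integrable_finsetSum _ fun j _ => (integrable_tent k j μ).const_mul _
  have hg : ∫ x, ∑ j ∈ s, f (j / (k + 1)) * tent k j x ∂μ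
      = ∑ j ∈ s, f (j / (k + 1)) * ∫ x, tent k j x ∂μ := by
    rw [integral_finsetSum _ fun j _ => (integrable_tent k j μ).const_mul _]
    exact Finset.sum_congr rfl fun j _ => integral_const_mul _ _
  have hr : ∫ x, (1 / ((k : ℝ) + 1) + B * (1 - ∑ j ∈ s, tent k j x)) ∂μ
      = 1 / ((k : ℝ) + 1) + B * (1 - ∑ j ∈ s, ∫ x, tent k j x ∂μ) := by
    have hi : Integrable (fun x => 1 - ∑ j ∈ s, tent k j x) μ := (integrable_const _).sub hχi
    rw [integral_add (integrable_const _) (hi.const_mul _),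
      integral_const_mul, integral_sub (integrable_const _) hχi,
      integral_finsetSum _ fun j _ => integrable_tent k j μ]
    simp
  rw [← hg, ← integral_sub hfi hgi, ← hr]
  refine (abs_integral_le_integral_abs).trans (integral_mono (hfi.sub hgi).abs
    ((integrable_const _).add (((integrable_const _).sub hχi).const_mul _)) fun x => ?_)
  exact abs_sub_sum_tent_le hB hf k s x

/-- Convergence of the integrals of the countably many tents implies convergence of the
integrals of all bounded `1`-Lipschitz functions. -/
lemma tendsto_integral_of_forall_tent {μ : ℕ → Measure ℝ} {γ : Measure ℝ}
    [IsProbabilityMeasure γ] (hμ : ∀ᶠ N in atTop, IsProbabilityMeasure (μ N))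
    (h : ∀ k j, Tendsto (fun N => ∫ x, tent k j x ∂(μ N)) atTop (nhds (∫ x, tent k j x ∂γ)))
    {f : ℝ → ℝ} {B : ℝ} (hB : ∀ x, |f x| ≤ B) (hf : LipschitzWith 1 f) :
    Tendsto (fun N => ∫ x, f x ∂(μ N)) atTop (nhds (∫ x, f x ∂γ)) := by
  have hfl : ∀ x y, |f x - f y| ≤ |x - y| := fun x y => by
    simpa [Real.dist_eq] using hf.dist_le_mul x y
  rw [Metric.tendsto_nhds]
  intro δ hδ
  obtain ⟨ε, hε, rfl⟩ : ∃ ε > 0, δ = 5 * ε := ⟨δ / 5, by positivity, by ring⟩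
  obtain ⟨k, hk⟩ := exists_nat_one_div_lt hε
  have hχγ : Tendsto (fun J : ℕ => B * (1 - ∑ j ∈ Finset.Icc (-(J : ℤ)) J, ∫ x, tent k j x ∂γ))
      atTop (nhds (B * (1 - 1))) := by
    refine ((tendsto_const_nhds.sub ((tendsto_integral_sum_tent k γ).congr fun J => ?_)).const_mul B)
    exact integral_finsetSum _ fun j _ => integrable_tent k j γ
  rw [sub_self, mul_zero] at hχγ
  obtain ⟨J, hJ⟩ := (hχγ.eventually_lt_const hε).exists
  set s := Finset.Icc (-(J : ℤ)) J
  have hχ : Tendsto (fun N => B * (1 - ∑ j ∈ s, ∫ x, tent k j x ∂(μ N))) atTop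
      (nhds (B * (1 - ∑ j ∈ s, ∫ x, tent k j x ∂γ))) :=
    (tendsto_const_nhds.sub (tendsto_finsetSum _ fun j _ => h k j)).const_mul B
  have hg : Tendsto (fun N => ∑ j ∈ s, f (j / (k + 1)) * ∫ x, tent k j x ∂(μ N)) atTop
      (nhds (∑ j ∈ s, f (j / (k + 1)) * ∫ x, tent k j x ∂γ)) :=
    tendsto_finsetSum _ fun j _ => (h k j).const_mul _
  filter_upwards [hμ, hχ.eventually_lt_const hJ, Metric.tendsto_nhds.1 hg ε hε]
    with N hN h1 h2
  have h3 := abs_integral_sub_sum_tent_le hB hf.continuous hfl k s (μ N)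
  have h4 := abs_integral_sub_sum_tent_le hB hf.continuous hfl k s γ
  rw [Real.dist_eq] at h2 ⊢
  rw [abs_le] at h3 h4
  rw [abs_lt] at h2 ⊢
  constructor <;> linarith [h2.1, h2.2, h3.1, h3.2, h4.1, h4.2]

/-- The quenched law of the normalized energy of a uniformly random up-right path. -/
noncomputable def quenchedLaw (N M : ℕ) (w : ↥(box N M) → ℝ) : Measure ℝ :=
  ((upRightPaths N M).card : ENNReal)⁻¹ • ∑ s ∈ upRightPaths N M,
    Measure.dirac ((√((M + N - 1 : ℕ) : ℝ))⁻¹ *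
        ∑ a : ↥(box N M), if (a : ℕ × ℕ) ∈ s then w a else 0)

lemma isProbabilityMeasure_quenchedLaw {N M : ℕ} (hN : 0 < N) (hM : 0 < M)
    (w : ↥(box N M) → ℝ) : IsProbabilityMeasure (quenchedLaw N M w) := by
  obtain ⟨n, rfl⟩ := Nat.exists_eq_succ_of_ne_zero hN.ne'
  obtain ⟨b, rfl⟩ := Nat.exists_eq_succ_of_ne_zero hM.ne'
  refine ⟨?_⟩
  have hc : (upRightPaths n.succ b.succ).card ≠ 0 := by
    rw [Nat.succ_eq_add_one, Nat.succ_eq_add_one, card_upRightPaths]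
    exact (Nat.choose_pos (Nat.le_add_right n b)).ne'
  simp only [quenchedLaw, Measure.smul_apply, Measure.finsetSum_apply, measure_univ,
    Finset.sum_const, smul_eq_mul, nsmul_eq_mul, mul_one]
  exact ENNReal.inv_mul_cancel (Nat.cast_ne_zero.2 hc) (ENNReal.natCast_ne_top _)

lemma pathAvgCentered_zero_eq_integral (N M : ℕ) (w : ↥(box N M) → ℝ) (f : ℝ → ℝ) :
    pathAvgCentered N M w 0 f = ∫ x, f x ∂(quenchedLaw N M w) := by
  rw [quenchedLaw, integral_smul_measure,
    integral_finsetSum_measure fun s _ => integrable_dirac (by finiteness)]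
  simp [pathAvgCentered, integral_dirac]

/-- Quenched CLT along up-right paths with weights uniform on the sphere `√(NM)·S^{NM-1}`. -/
theorem stmt10
    (ξ : ℝ) (hξ : 0 < ξ)
    (M : ℕ → ℕ) (hM : ∀ N, M N = ⌊ξ * (N : ℝ)⌋₊)
    (Ω : Type) [MeasurableSpace Ω] (P : Measure Ω) [IsProbabilityMeasure P]
    (W : ∀ N : ℕ, Ω → EuclideanSpace ℝ ↥(box N (M N)))
    (hmeas : ∀ N, Measurable (W N))
    (hlaw : ∀ N, Measure.map (W N) P =
      sphereUniform ↥(box N (M N)) (Real.sqrt ((N * M N : ℕ) : ℝ))) :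
    ∀ᵐ ω ∂P, ∀ f : ℝ → ℝ, (∃ B, ∀ x, |f x| ≤ B) → LipschitzWith 1 f →
      Tendsto
        (fun N => pathAvgCentered N (M N) (fun a => W N ω a)
          (fun a => ∫ ω', W N ω' a ∂P) f)
        atTop (nhds (∫ x, f x ∂(gaussianReal 0 1))) := by
  have hprob : ∀ N, IsProbabilityMeasure (sphereUniform ↥(box N (M N)) (√((N * M N : ℕ) : ℝ))) :=
    fun N => hlaw N ▸ Measure.isProbabilityMeasure_map (hmeas N).aemeasurable
  have hmean : ∀ N, (fun a => ∫ ω', W N ω' a ∂P) = 0 := by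
    intro N
    funext a
    have := hprob N
    rw [Pi.zero_apply, ← integral_apply_sphereUniform ↥(box N (M N)) (√((N * M N : ℕ) : ℝ)) a,
      ← hlaw N, integral_map (hmeas N).aemeasurable
        (by fun_prop : Measurable fun w : EuclideanSpace ℝ ↥(box N (M N)) => w a).aestronglyMeasurable]
  simp only [hmean]
  have htent : ∀ᵐ ω ∂P, ∀ k j, Tendsto
      (fun N => pathAvgCentered N (M N) (fun a => W N ω a) 0 (tent k j)) atTop
      (nhds (∫ x, tent k j x ∂(gaussianReal 0 1))) := by
    simp only [ae_all_iff]
    exact fun k j => ae_tendsto_pathAvgCentered hξ hM hmeas hlaw (continuous_tent k j).measurable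
      (abs_tent_le_one k j) (by positivity) (abs_tent_sub_le k j)
  have hpos : ∀ᶠ N in atTop, 0 < N ∧ 0 < M N := by
    filter_upwards [eventually_mul_le_floor hξ, eventually_gt_atTop 0] with N hMN hN
    rw [← hM N] at hMN
    have hNr : (0 : ℝ) < N := Nat.cast_pos.2 hN
    exact ⟨hN, Nat.cast_pos.1 (lt_of_lt_of_le (by positivity) hMN)⟩
  filter_upwards [htent] with ω hω f ⟨B, hB⟩ hf
  simp only [pathAvgCentered_zero_eq_integral] at hω ⊢
  refine tendsto_integral_of_forall_tent ?_ hω hB hf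
  filter_upwards [hpos] with N hN
  exact isProbabilityMeasure_quenchedLaw hN.1 hN.2 _
end
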